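/- Let M ⪯ N be models of a complete distal (hence NIP) first-order L-theory, with N sufficiently saturated. Let φ(x,y) be an L-formula with parameters from M, let b be a tuple from N not in M with q(y) = tp(b/M), and assume φ(x,b) does not divide over M. Then there exist an L-formula θ(x,z) with parameters from M, a natural number k with |z| = k·|y|, and a complete type r(z) over M, such that for every finite set B of tuples from N realizing q(y), there is a tuple c from N with: (1) c realizes r; (2) θ(x,c) does not divide over M; and (3) for all d ∈ B, N ⊨ ∀x (θ(x,c) → φ(x,d)). -/

import Mathlib

open FirstOrder FirstOrder.Language

universe u v w

namespace DistalPaper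

variable (L : FirstOrder.Language.{u, v})

def SameTypeOver {N : Type w} [L.Structure N] (A : Set N) {γ : Type*} (b b' : γ → N) : Prop :=
  ∀ (p : ℕ) (φ : L.Formula (γ ⊕ Fin p)) (m : Fin p → N), (∀ i, m i ∈ A) →
    (φ.Realize (Sum.elim b m) ↔ φ.Realize (Sum.elim b' m))

def IsIndiscernibleOver {N : Type w} [L.Structure N] (A : Set N) {I : Type*} [LinearOrder I]
    {γ : Type*} (b : I → γ → N) : Prop :=
  ∀ (m : ℕ) (i j : Fin m → I), StrictMono i → StrictMono j →
    SameTypeOver L A (fun q : Fin m × γ => b (i q.1) q.2) (fun q : Fin m × γ => b (j q.1) q.2)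

def IsConsistentFamily {N : Type w} [L.Structure N] {α γ ι : Type*}
    (φ : L.Formula (α ⊕ γ)) (b : ι → γ → N) : Prop :=
  ∀ s : Finset ι, ∃ a : α → N, ∀ i ∈ s, φ.Realize (Sum.elim a (b i))

structure ElemExt (N : Type w) [L.Structure N] where
  Carrier : Type max u v w
  [str : L.Structure Carrier]
  emb : N ↪ₑ[L] Carrier

attribute [instance] ElemExt.str

def Divides {N : Type w} [L.Structure N] (A : Set N) {α γ : Type*}
    (φ : L.Formula (α ⊕ γ)) (b : γ → N) : Prop :=
  ∃ (E : ElemExt L N) (c : ℕ → γ → E.Carrier),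
    IsIndiscernibleOver L (⇑E.emb '' A) c ∧
    SameTypeOver L (⇑E.emb '' A) (c 0) (⇑E.emb ∘ b) ∧
    ¬ IsConsistentFamily L φ c

/-- The formula `φ(x, b)` forks over `A`: in some elementary extension it implies a finite
disjunction of formulas, each of which divides over (the image of) `A`. -/
def Forks {N : Type w} [L.Structure N] (A : Set N) {α γ : Type*}
    (φ : L.Formula (α ⊕ γ)) (b : γ → N) : Prop :=
  ∃ (E : ElemExt L N) (k m : ℕ) (ψ : Fin k → L.Formula (α ⊕ Fin m))
    (c : Fin k → Fin m → E.Carrier),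
    (∀ i, Divides L (⇑E.emb '' A) (ψ i) (c i)) ∧
    ∀ a : α → E.Carrier, φ.Realize (Sum.elim a (⇑E.emb ∘ b)) →
      ∃ i, (ψ i).Realize (Sum.elim a (c i))

/-- The complete type of the tuple `bs` over the parameter set `P` does not fork over `A`:
no formula with parameters from `P` satisfied by `bs` forks over `A`. -/
def TypeDoesNotForkOver {N : Type w} [L.Structure N] (A P : Set N) {β : Type*}
    (bs : β → N) : Prop :=
  ∀ (p : ℕ) (φ : L.Formula (β ⊕ Fin p)) (c : Fin p → N), (∀ i, c i ∈ P) →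
    φ.Realize (Sum.elim bs c) → ¬ Forks L A φ c

/-- `tp(a / A ∪ bs)` is strictly non-forking over `A`: it extends to a complete type `p`
over a monster model (an elementary extension `E` of `N`, realized by `a'` in a further
elementary extension `F`) such that `p` does not fork over `A` and, for the realization
`a'` of `p`, `tp(bs / A a')` does not fork over `A`. -/
def StrictlyNonForkingOver {N : Type w} [L.Structure N] (A : Set N) {α β : Type*}
    (a : α → N) (bs : β → N) : Prop :=
  ∃ (E : ElemExt L N) (F : ElemExt L E.Carrier) (a' : α → F.Carrier),
    SameTypeOver L ((⇑F.emb ∘ ⇑E.emb) '' (A ∪ Set.range bs)) a' (⇑F.emb ∘ ⇑E.emb ∘ a) ∧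
    TypeDoesNotForkOver L ((⇑F.emb ∘ ⇑E.emb) '' A) (Set.range ⇑F.emb) a' ∧
    TypeDoesNotForkOver L ((⇑F.emb ∘ ⇑E.emb) '' A)
      (((⇑F.emb ∘ ⇑E.emb) '' A) ∪ Set.range a') (⇑F.emb ∘ ⇑E.emb ∘ bs)

/-- `b` is a strict Morley sequence over `A` for the complete type (over `A`) of the
tuple `q`: an `A`-indiscernible sequence of realizations of `tp(q/A)` such that each
`tp(b (n+1) / A, b 0, ..., b n)` is strictly non-forking over `A`. -/
def IsStrictMorleySequence {N : Type w} [L.Structure N] (A : Set N) {γ : Type*}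
    (q : γ → N) (b : ℕ → γ → N) : Prop :=
  IsIndiscernibleOver L A b ∧
  (∀ n, SameTypeOver L A (b n) q) ∧
  ∀ n : ℕ, StrictlyNonForkingOver L A (b (n + 1)) (fun p : Fin (n + 1) × γ => b ↑p.1 p.2)

/-- `N` (equivalently, its complete theory) is NIP: no formula `φ(x, y)` has the
independence property in any model of `Th(N)`. -/
def IsNIP (N : Type w) [L.Structure N] : Prop :=
  ∀ (nx ny : ℕ) (φ : L.Formula (Fin nx ⊕ Fin ny)),
    ¬ ∃ (K : Theory.ModelType.{u, v, max u v w} (L.completeTheory N))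
        (a : ℕ → Fin nx → K) (bS : Set ℕ → Fin ny → K),
        ∀ (i : ℕ) (S : Set ℕ), φ.Realize (Sum.elim (a i) (bS S)) ↔ i ∈ S

/-- `N` is distal: it is NIP and, in every elementary extension, for every indiscernible
sequence `(b i)_{i ∈ ℤ}` and parameter set `A`, if the sequence with `b 0` omitted is
indiscernible over `A`, then the whole sequence is indiscernible over `A`. -/
def IsDistal (N : Type w) [L.Structure N] : Prop :=
  IsNIP L N ∧
  ∀ (E : ElemExt L N) (m : ℕ) (b : ℤ → Fin m → E.Carrier) (A : Set E.Carrier),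
    IsIndiscernibleOver L (∅ : Set E.Carrier) b →
    IsIndiscernibleOver L A (fun i : {i : ℤ // i ≠ 0} => b ↑i) →
    IsIndiscernibleOver L A b

/-- `N` is `κ`-saturated: every finitely satisfiable family of formulas in finitely many
free variables with parameters from a set of size `< κ` is realized in `N`. -/
def IsSaturated (κ : Cardinal.{w}) (N : Type w) [L.Structure N] : Prop :=
  ∀ (A : Set N), Cardinal.mk A < κ →
    ∀ (n : ℕ) (ι : Type max u v w) (p : ι → ℕ) (φ : ∀ i, L.Formula (Fin n ⊕ Fin (p i)))
      (c : ∀ i, Fin (p i) → N), (∀ i j, c i j ∈ A) →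
      (∀ s : Finset ι, ∃ a : Fin n → N, ∀ i ∈ s, (φ i).Realize (Sum.elim a (c i))) →
      ∃ a : Fin n → N, ∀ i, (φ i).Realize (Sum.elim a (c i))

/-- The complete type of `a` over the parameter set `P` (with `A ⊆ P`) extends to a
complete type over all of `N` which is `A`-invariant; the extension is encoded by a
realization `a'` in an elementary extension of `N`. -/
def ExtendsToInvariantType {N : Type w} [L.Structure N] (A P : Set N) {α : Type*}
    (a : α → N) : Prop :=
  ∃ (E : ElemExt L N) (a' : α → E.Carrier),
    SameTypeOver L (⇑E.emb '' P) a' (⇑E.emb ∘ a) ∧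
    ∀ (p : ℕ) (φ : L.Formula (α ⊕ Fin p)) (c c' : Fin p → N),
      SameTypeOver L A c c' →
      (φ.Realize (Sum.elim a' (⇑E.emb ∘ c)) ↔ φ.Realize (Sum.elim a' (⇑E.emb ∘ c')))

/-- Two sequences have the same Ehrenfeucht–Mostowski type over `A`: increasing tuples
of the same length from either sequence have the same type over `A`. -/
def SameEMTypeOver {N : Type w} [L.Structure N] (A : Set N) {I J : Type*}
    [LinearOrder I] [LinearOrder J] {γ : Type*} (b : I → γ → N) (d : J → γ → N) : Prop :=
  ∀ (m : ℕ) (i : Fin m → I) (j : Fin m → J), StrictMono i → StrictMono j →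
    SameTypeOver L A (fun q : Fin m × γ => b (i q.1) q.2) (fun q : Fin m × γ => d (j q.1) q.2)

/-- Insert the tuple `d` at position `0` into a sequence indexed by the nonzero integers. -/
def insertAtZero {X γ : Type*} (d : γ → X) (ds : {i : ℤ // i ≠ 0} → γ → X) : ℤ → γ → X :=
  fun i => if h : i = 0 then d else ds ⟨i, h⟩


section Helpers

variable {L : FirstOrder.Language.{u, v}} {N : Type w} [L.Structure N]

/-! ### Ultrapowers as elementary extensions -/

theorem exists_ultraExt [Nonempty N] {ι : Type w} (U : Ultrafilter ι) :
    ∃ (E : ElemExt L N) (cls : (ι → N) → E.Carrier),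
      (∀ c : N, cls (fun _ => c) = E.emb c) ∧
      ∀ (γ : Type) (ψ : L.Formula γ) (x : γ → ι → N),
        ψ.Realize (fun i => cls (x i)) ↔ ∀ᶠ j in (U : Filter ι), ψ.Realize (fun i => x i j) := by
  let P := (U : Filter ι).Product (fun _ => N)
  let e : P ≃ ULift.{max u v} P := Equiv.ulift.symm
  letI : L.Structure (ULift.{max u v} P) := e.inducedStructure
  let e' : P ≃[L] ULift.{max u v} P := Equiv.inducedStructureEquiv e
  let cl : (ι → N) → P := fun x => (x : (U : Filter ι).Product (fun _ => N))
  let em : N ↪ₑ[L] P :=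
    { toFun := fun c => cl (fun _ => c)
      map_formula' := by
        intro n ψ x
        have := Ultraproduct.realize_formula_cast (L := L) (M := fun _ : ι => N) (u := U) ψ
          (fun i _ => x i)
        refine Iff.trans this ?_
        simp }
  refine ⟨⟨ULift.{max u v} P, e'.toElementaryEmbedding.comp em⟩, fun x => e' (cl x), ?_, ?_⟩
  · intro c; rfl
  · intro γ ψ x
    rw [← Ultraproduct.realize_formula_cast (L := L) (M := fun _ : ι => N) (u := U) ψ x]
    exact (StrongHomClass.realize_formula e' ψ (v := fun i => cl (x i)))

/-- finite support of formulas, in the second summand -/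
theorem formula_support {γ : Type*} {A : Type*} (ψ : L.Formula (γ ⊕ A)) :
    ∃ (p : ℕ) (ψ' : L.Formula (γ ⊕ Fin p)) (m : Fin p → A),
      ∀ (K : Type w) [L.Structure K] (x : γ → K) (f : A → K),
        ψ'.Realize (Sum.elim x (f ∘ m)) ↔ ψ.Realize (Sum.elim x f) := by
  classical
  let F := BoundedFormula.freeVarFinset ψ
  let G : Finset A := F.toRight
  let eq := G.equivFin
  let g : F → γ ⊕ Fin G.card := fun a => match a with
    | ⟨Sum.inl c, _⟩ => Sum.inl c
    | ⟨Sum.inr c, h⟩ => Sum.inr (eq ⟨c, Finset.mem_toRight.2 h⟩)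
  refine ⟨G.card, BoundedFormula.restrictFreeVar ψ g, fun i => (eq.symm i).1, ?_⟩
  intro K _ x f
  refine BoundedFormula.realize_restrictFreeVar _ ?_
  rintro ⟨a | a, h⟩
  · rfl
  · simp [g]

theorem formula_support' {γ : Type*} (ψ : L.Formula γ) :
    ∃ F : Finset γ, ∀ (x y : γ → N), (∀ i ∈ F, x i = y i) → (ψ.Realize x ↔ ψ.Realize y) := by
  classical
  refine ⟨BoundedFormula.freeVarFinset ψ, fun x y h => ?_⟩
  have h1 := BoundedFormula.realize_restrictFreeVar (M := N) (φ := ψ) (xs := default)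
    (f := fun a => a) (v := fun a => x a) x (fun a => rfl)
  have h2 := BoundedFormula.realize_restrictFreeVar (M := N) (φ := ψ) (xs := default)
    (f := fun a => a) (v := fun a => x a) y (fun a => h a a.2)
  exact h1.symm.trans h2

/-! ### Definable predicates over `M` -/

variable (M : L.ElementarySubstructure N)

/-- `P` is definable with parameters from `M` -/
def MDef {γ : Type*} (P : (γ → N) → Prop) : Prop :=
  ∃ ψ : L.Formula (γ ⊕ M), ∀ x, ψ.Realize (Sum.elim x ((↑) : M → N)) ↔ P x

variable {M}

theorem MDef.congr {γ : Type*} {P Q : (γ → N) → Prop} (h : MDef M P) (hh : ∀ x, P x ↔ Q x) :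
    MDef M Q := by
  obtain ⟨ψ, hψ⟩ := h
  exact ⟨ψ, fun x => (hψ x).trans (hh x)⟩

theorem MDef.not {γ : Type*} {P : (γ → N) → Prop} (h : MDef M P) : MDef M (fun x => ¬ P x) := by
  obtain ⟨ψ, hψ⟩ := h
  exact ⟨ψ.not, fun x => by rw [Formula.realize_not, hψ]⟩

theorem MDef.and {γ : Type*} {P Q : (γ → N) → Prop} (h : MDef M P) (h' : MDef M Q) :
    MDef M (fun x => P x ∧ Q x) := by
  obtain ⟨ψ, hψ⟩ := h
  obtain ⟨ψ', hψ'⟩ := h'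
  exact ⟨ψ ⊓ ψ', fun x => by rw [Formula.realize_inf, hψ, hψ']⟩

theorem MDef.or {γ : Type*} {P Q : (γ → N) → Prop} (h : MDef M P) (h' : MDef M Q) :
    MDef M (fun x => P x ∨ Q x) := by
  obtain ⟨ψ, hψ⟩ := h
  obtain ⟨ψ', hψ'⟩ := h'
  exact ⟨ψ ⊔ ψ', fun x => by rw [Formula.realize_sup, hψ, hψ']⟩

theorem MDef.imp {γ : Type*} {P Q : (γ → N) → Prop} (h : MDef M P) (h' : MDef M Q) :
    MDef M (fun x => P x → Q x) :=
  (h.not.or h').congr fun x => by tauto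

theorem MDef.iff {γ : Type*} {P Q : (γ → N) → Prop} (h : MDef M P) (h' : MDef M Q) :
    MDef M (fun x => P x ↔ Q x) :=
  ((h.imp h').and (h'.imp h)).congr fun x => by tauto

theorem MDef.true {γ : Type*} : MDef M (fun _ : γ → N => True) :=
  ⟨⊤, fun x => by simp⟩

theorem MDef.false {γ : Type*} : MDef M (fun _ : γ → N => False) :=
  ⟨⊥, fun x => by simp⟩

theorem MDef.forallFin {γ : Type*} {ι : Type*} [Finite ι] {P : ι → (γ → N) → Prop}
    (h : ∀ i, MDef M (P i)) : MDef M (fun x => ∀ i, P i x) := by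
  choose ψ hψ using h
  exact ⟨Formula.iInf ψ, fun x => by simp [hψ]⟩

/-- substitution: every coordinate of `f x` is a coordinate of `x` or an element of `M` -/
theorem MDef.subst {γ γ' : Type*} {P : (γ → N) → Prop} (h : MDef M P)
    (f : (γ' → N) → (γ → N)) (σ : γ → γ' ⊕ M)
    (hf : ∀ x i, f x i = Sum.elim x ((↑) : M → N) (σ i)) :
    MDef M (fun x => P (f x)) := by
  obtain ⟨ψ, hψ⟩ := h
  refine ⟨ψ.relabel (Sum.elim σ Sum.inr), fun x => ?_⟩
  rw [Formula.realize_relabel]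
  refine Iff.trans ?_ (hψ _)
  apply iff_of_eq
  congr 1
  funext i
  cases i with
  | inl i => simp [hf]
  | inr i => rfl

theorem MDef.pre {γ γ' : Type*} {P : (γ → N) → Prop} (h : MDef M P)
    (f : (γ' → N) → (γ → N)) (σ : γ → γ') (hf : ∀ x i, f x i = x (σ i)) :
    MDef M (fun x => P (f x)) :=
  h.subst f (fun i => Sum.inl (σ i)) (fun x i => by rw [hf]; rfl)

theorem MDef.ex {γ ξ : Type*} [Finite ξ] {P : (γ ⊕ ξ → N) → Prop} (h : MDef M P) :
    MDef M (fun x : γ → N => ∃ a : ξ → N, P (Sum.elim x a)) := by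
  obtain ⟨ψ, hψ⟩ := h
  refine ⟨Formula.iExs ξ (ψ.relabel (Sum.elim (Sum.elim (fun i => Sum.inl (Sum.inl i)) Sum.inr)
    (fun i => Sum.inl (Sum.inr i)))), fun x => ?_⟩
  rw [Formula.realize_iExs]
  refine exists_congr fun a => ?_
  rw [Formula.realize_relabel]
  refine Iff.trans ?_ (hψ _)
  apply iff_of_eq
  congr 1
  funext i
  rcases i with (i | i) | i <;> rfl

theorem MDef.all {γ ξ : Type*} [Finite ξ] {P : (γ ⊕ ξ → N) → Prop} (h : MDef M P) :
    MDef M (fun x : γ → N => ∀ a : ξ → N, P (Sum.elim x a)) :=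
  h.not.ex.not.congr fun x => by push Not; rfl

/-- all coordinates in `M` -/
def MPt (M : L.ElementarySubstructure N) {γ : Type*} (x : γ → N) : Prop := ∀ i, x i ∈ M

/-- `M` is an elementary substructure -/
theorem MDef.exists_mpt {γ : Type*} [Finite γ] {P : (γ → N) → Prop} (h : MDef M P)
    (hx : ∃ x, P x) : ∃ x, P x ∧ MPt M x := by
  obtain ⟨ψ, hψ⟩ := h
  let χ : L.Formula M := Formula.iExs γ (ψ.relabel Sum.swap)
  have h1 : χ.Realize ((↑) : M → N) := by
    obtain ⟨x, hx⟩ := hx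
    rw [Formula.realize_iExs]
    refine ⟨x, ?_⟩
    rw [Formula.realize_relabel]
    rw [← hψ] at hx
    convert hx using 1
    funext i; cases i <;> rfl
  have h2 : χ.Realize (id : M → M) := by
    rw [← M.subtype.map_formula χ id]
    exact h1
  rw [Formula.realize_iExs] at h2
  obtain ⟨y, hy⟩ := h2
  rw [← M.subtype.map_formula, Formula.realize_relabel] at hy
  refine ⟨fun i => (y i : N), ?_, fun i => (y i).2⟩
  rw [← hψ]
  convert hy using 1
  funext i; cases i <;> rfl

theorem MDef.support {γ : Type*} {P : (γ → N) → Prop} (h : MDef M P) :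
    ∃ F : Finset γ, ∀ (x y : γ → N), (∀ i ∈ F, x i = y i) → (P x ↔ P y) := by
  classical
  obtain ⟨ψ, hψ⟩ := h
  obtain ⟨F, hF⟩ := formula_support' (N := N) ψ
  refine ⟨F.toLeft, fun x y hxy => ?_⟩
  rw [← hψ, ← hψ]
  apply hF
  rintro (i | i) hi
  · exact hxy i (Finset.mem_toLeft.2 hi)
  · rfl

variable (M)
/-- same type over `M` -/
def TEq {γ : Type*} (x y : γ → N) : Prop := ∀ P : (γ → N) → Prop, MDef M P → P x → P y
variable {M}

theorem TEq.refl {γ : Type*} (x : γ → N) : TEq M x x := fun _ _ h => h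

theorem TEq.symm {γ : Type*} {x y : γ → N} (h : TEq M x y) : TEq M y x := by
  intro P hP hy
  by_contra hx
  exact h _ hP.not hx hy

theorem TEq.trans {γ : Type*} {x y z : γ → N} (h : TEq M x y) (h' : TEq M y z) : TEq M x z :=
  fun P hP hx => h' P hP (h P hP hx)

theorem TEq.iff {γ : Type*} {x y : γ → N} (h : TEq M x y) {P : (γ → N) → Prop} (hP : MDef M P) :
    P x ↔ P y := ⟨h P hP, h.symm P hP⟩

theorem TEq.pre {γ γ' : Type*} {x y : γ → N} (h : TEq M x y) (σ : γ' → γ) {x' y' : γ' → N}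
    (hx : ∀ i, x' i = x (σ i)) (hy : ∀ i, y' i = y (σ i)) : TEq M x' y' := by
  intro P hP hp
  have e1 : x' = x ∘ σ := funext hx
  have e2 : y' = y ∘ σ := funext hy
  subst e1 e2
  exact h _ (hP.pre (fun z => z ∘ σ) σ (fun _ _ => rfl)) hp

theorem tEq_of_same {γ : Type} {x y : γ → N}
    (h : SameTypeOver L (M : Set N) x y) : TEq M x y := by
  rintro P ⟨ψ, hψ⟩ hp
  classical
  let F := BoundedFormula.freeVarFinset ψ
  let G : Finset M := F.toRight
  let eq := G.equivFin
  let g : F → γ ⊕ Fin G.card := fun a => match a with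
    | ⟨Sum.inl c, _⟩ => Sum.inl c
    | ⟨Sum.inr c, h⟩ => Sum.inr (eq ⟨c, Finset.mem_toRight.2 h⟩)
  have key : ∀ z : γ → N, Formula.Realize (L := L) (BoundedFormula.restrictFreeVar ψ g)
      (Sum.elim z (fun i => ((eq.symm i).1 : N))) ↔ P z := by
    intro z
    rw [← hψ]
    refine BoundedFormula.realize_restrictFreeVar _ ?_
    rintro ⟨a | a, h⟩
    · rfl
    · simp [g]
  rw [← key] at hp ⊢
  exact (h _ _ _ (fun i => (eq.symm i).1.2)).1 hp

theorem mdef_of_formula {γ : Type*} {p : ℕ} (φ : L.Formula (γ ⊕ Fin p)) (m : Fin p → N)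
    (hm : ∀ i, m i ∈ M) : MDef M (fun x : γ → N => φ.Realize (Sum.elim x m)) := by
  refine ⟨φ.relabel (Sum.map id (fun i => (⟨m i, hm i⟩ : M))), fun x => ?_⟩
  rw [Formula.realize_relabel]
  apply iff_of_eq; congr 1
  funext i; cases i <;> rfl

theorem TEq.same {γ : Type*} {x y : γ → N} (h : TEq M x y) :
    SameTypeOver L (M : Set N) x y := by
  intro p φ m hm
  exact h.iff (mdef_of_formula φ m hm)

end Helpers

section Helpers2

variable {L : FirstOrder.Language.{u, v}} {N : Type w} [L.Structure N]
variable {M : L.ElementarySubstructure N}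

theorem MDef.exl {γ ξ : Type*} [Finite ξ] {P : (ξ ⊕ γ → N) → Prop} (h : MDef M P) :
    MDef M (fun x : γ → N => ∃ a : ξ → N, P (Sum.elim a x)) := by
  have h1 : MDef M (fun x : γ ⊕ ξ → N => P (fun i => x (Sum.swap i))) :=
    h.pre _ Sum.swap (fun _ _ => rfl)
  refine h1.ex.congr fun x => exists_congr fun a => ?_
  apply iff_of_eq; congr 1
  funext i; cases i <;> rfl

theorem MDef.alll {γ ξ : Type*} [Finite ξ] {P : (ξ ⊕ γ → N) → Prop} (h : MDef M P) :
    MDef M (fun x : γ → N => ∀ a : ξ → N, P (Sum.elim a x)) :=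
  h.not.exl.not.congr fun x => by push Not; rfl

theorem MDef.existsFin {γ : Type*} {ι : Type*} [Finite ι] {P : ι → (γ → N) → Prop}
    (h : ∀ i, MDef M (P i)) : MDef M (fun x => ∃ i, P i x) :=
  (MDef.forallFin (fun i => (h i).not)).not.congr fun x => by push Not; rfl

variable (M)

/-- semantic form of saturation -/
def SatP : Prop := ∀ (γ δ : Type) [Finite γ] [Finite δ] (c : δ → N)
    (S : ((γ ⊕ δ → N) → Prop) → Prop), (∀ s, S s → MDef M s) →
    (∀ s t, S s → S t → S (fun x => s x ∧ t x)) → (∀ s, S s → ∃ a, s (Sum.elim a c)) →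
    ∃ a, ∀ s, S s → s (Sum.elim a c)

variable {M}

theorem satP_of (hsat : IsSaturated L (Order.succ (Cardinal.mk M)) N) (hinf : Infinite M) :
    SatP M := by
  intro γ δ _ _ c S hS hand hex
  classical
  obtain ⟨n, ⟨en⟩⟩ := Finite.exists_equiv_fin γ
  have hN : Nonempty N := ⟨((Classical.arbitrary M : M) : N)⟩
  let A : Set N := (M : Set N) ∪ Set.range c
  have hA : Cardinal.mk A < Order.succ (Cardinal.mk M) := by
    rw [Order.lt_succ_iff]
    refine (Cardinal.mk_union_le _ _).trans ?_
    have h0 : Cardinal.aleph0 ≤ Cardinal.mk M := Cardinal.aleph0_le_mk M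
    refine Cardinal.add_le_of_le h0 le_rfl ?_
    exact (Cardinal.lt_aleph0_of_finite (Set.range c)).le.trans h0
  let I := {ψ : L.Formula ((γ ⊕ δ) ⊕ M) // S (fun x => ψ.Realize (Sum.elim x ((↑) : M → N)))}
  let rel : (γ ⊕ δ) ⊕ M → Fin n ⊕ (δ ⊕ M) :=
    Sum.elim (Sum.elim (fun i => Sum.inl (en i)) (fun i => Sum.inr (Sum.inl i)))
      (fun i => Sum.inr (Sum.inr i))
  have key : ∀ i : I, ∃ (p : ℕ) (ψ' : L.Formula (Fin n ⊕ Fin p)) (m : Fin p → δ ⊕ M),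
      ∀ (x : Fin n → N), ψ'.Realize (Sum.elim x ((Sum.elim c ((↑) : M → N)) ∘ m)) ↔
        i.1.Realize (Sum.elim (Sum.elim (x ∘ en) c) ((↑) : M → N)) := by
    intro i
    obtain ⟨p, ψ', m, h⟩ := formula_support (i.1.relabel rel)
    refine ⟨p, ψ', m, fun x => (h N x _).trans ?_⟩
    rw [Formula.realize_relabel]
    apply iff_of_eq; congr 1
    funext i; rcases i with (i | i) | i <;> rfl
  choose p ψ' m hm using key
  obtain ⟨a, ha⟩ := hsat A hA n I p ψ' (fun i => Sum.elim c ((↑) : M → N) ∘ m i) (by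
    intro i j
    show Sum.elim c ((↑) : M → N) (m i j) ∈ A
    rcases m i j with y | y
    · exact Or.inr ⟨y, rfl⟩
    · exact Or.inl y.2) (by
    intro s
    have : (∃ t, S t ∧ ∀ i ∈ s, ∀ x, t x → i.1.Realize (Sum.elim x ((↑) : M → N))) ∨ s = ∅ := by
      induction s using Finset.induction_on with
      | empty => exact Or.inr rfl
      | insert i s _ ih =>
        left
        rcases ih with ⟨t, ht, hts⟩ | h
        · refine ⟨_, hand _ _ ht i.2, ?_⟩
          intro j hj x hx
          rcases Finset.mem_insert.1 hj with rfl | hj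
          · exact hx.2
          · exact hts j hj x hx.1
        · subst h
          refine ⟨_, i.2, ?_⟩
          intro j hj x hx
          simp only [insert_empty_eq, Finset.mem_singleton] at hj
          subst hj; exact hx
    rcases this with ⟨t, ht, hts⟩ | h
    · obtain ⟨a, ha⟩ := hex t ht
      refine ⟨a ∘ en.symm, fun i hi => (hm i _).2 ?_⟩
      have := hts i hi _ ha
      convert this using 3
      funext j; simp
    · subst h
      exact ⟨fun _ => Classical.arbitrary N, by simp⟩)
  refine ⟨a ∘ en, fun s hs => ?_⟩
  obtain ⟨ψ, hψ⟩ := hS s hs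
  have e : (fun x => ψ.Realize (Sum.elim x ((↑) : M → N))) = s := funext fun x => propext (hψ x)
  have := (hm ⟨ψ, by rw [e]; exact hs⟩ a).1 (ha _)
  exact (hψ _).1 this

theorem SatP.homog (H : SatP M) {γ δ : Type} [Finite γ] [Finite δ] {g g' : δ → N}
    (h : TEq M g g') (f : γ → N) : ∃ f' : γ → N, TEq M (Sum.elim f g) (Sum.elim f' g') := by
  obtain ⟨a, ha⟩ := H γ δ g' (fun s => MDef M s ∧ s (Sum.elim f g)) (fun s hs => hs.1)
    (fun s t hs ht => ⟨hs.1.and ht.1, hs.2, ht.2⟩) (fun s hs => h _ hs.1.exl ⟨f, hs.2⟩)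
  exact ⟨a, fun s hs hp => ha s ⟨hs, hp⟩⟩

/-! ### Realizations of coheirs -/

variable (M) in
/-- `h` realizes the restriction to `M c` of the global type given by `U` -/
def Rlz {β δ : Type} (U : Ultrafilter (β → N)) (c : δ → N) (h : β → N) : Prop :=
  ∀ s : (β ⊕ δ → N) → Prop, MDef M s → (∀ᶠ m in (U : Filter (β → N)), s (Sum.elim m c)) →
    s (Sum.elim h c)

variable (M) in
/-- `U` concentrates on `M`-points -/
def OnM {β : Type} (U : Ultrafilter (β → N)) : Prop := ∀ᶠ m in (U : Filter (β → N)), MPt M m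

theorem Rlz.iff {β δ : Type} {U : Ultrafilter (β → N)} {c : δ → N} {h : β → N}
    (hr : Rlz M U c h) {s : (β ⊕ δ → N) → Prop} (hs : MDef M s) :
    (∀ᶠ m in (U : Filter (β → N)), s (Sum.elim m c)) ↔ s (Sum.elim h c) := by
  refine ⟨hr s hs, fun h1 => ?_⟩
  by_contra h2
  rw [← Ultrafilter.eventually_not] at h2
  exact hr _ hs.not h2 h1

theorem SatP.exists_rlz (H : SatP M) {β δ : Type} [Finite β] [Finite δ]
    (U : Ultrafilter (β → N)) (c : δ → N) : ∃ h, Rlz M U c h := by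
  obtain ⟨a, ha⟩ := H β δ c
    (fun s => MDef M s ∧ ∀ᶠ m in (U : Filter (β → N)), s (Sum.elim m c)) (fun s hs => hs.1)
    (fun s t hs ht => ⟨hs.1.and ht.1, hs.2.and ht.2⟩) (fun s hs => hs.2.exists)
  exact ⟨a, fun s hs h => ha s ⟨hs, h⟩⟩

theorem MDef.fixl {β δ : Type*} {s : (β ⊕ δ → N) → Prop} (hs : MDef M s) {m : β → N}
    (hm : MPt M m) : MDef M (fun x : δ → N => s (Sum.elim m x)) :=
  hs.subst _ (Sum.elim (fun i => Sum.inr ⟨m i, hm i⟩) Sum.inl)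
    (fun x i => by cases i <;> rfl)

theorem MDef.fixr {β δ : Type*} {s : (β ⊕ δ → N) → Prop} (hs : MDef M s) {m : δ → N}
    (hm : MPt M m) : MDef M (fun x : β → N => s (Sum.elim x m)) :=
  hs.subst _ (Sum.elim Sum.inl (fun i => Sum.inr ⟨m i, hm i⟩))
    (fun x i => by cases i <;> rfl)

theorem OnM.inv {β δ : Type} {U : Ultrafilter (β → N)} (hU : OnM M U) {c c' : δ → N}
    (h : TEq M c c') {s : (β ⊕ δ → N) → Prop} (hs : MDef M s)
    (h1 : ∀ᶠ m in (U : Filter (β → N)), s (Sum.elim m c)) :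
    ∀ᶠ m in (U : Filter (β → N)), s (Sum.elim m c') := by
  filter_upwards [hU, h1] with m hm h2
  exact h _ (hs.fixl hm) h2

theorem Rlz.restrict {β δ δ' : Type} {U : Ultrafilter (β → N)} {c : δ → N} {h : β → N}
    (hr : Rlz M U c h) (σ : δ' → δ) {c' : δ' → N} (hc : ∀ i, c' i = c (σ i)) : Rlz M U c' h := by
  have e : c' = c ∘ σ := funext hc
  subst e
  intro s hs h1
  have hd : MDef M (fun x : β ⊕ δ → N => s (Sum.elim (fun i => x (Sum.inl i))
      (fun i => x (Sum.inr (σ i))))) :=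
    hs.pre _ (Sum.map id σ) (fun x i => by cases i <;> rfl)
  exact hr _ hd h1

theorem Rlz.tEq {β δ : Type} {U : Ultrafilter (β → N)} (hU : OnM M U) {c c' : δ → N}
    {h h' : β → N} (hr : Rlz M U c h) (hr' : Rlz M U c' h') (hc : TEq M c c') :
    TEq M (Sum.elim h c) (Sum.elim h' c') := by
  intro P hP hp
  exact hr' _ hP (hU.inv hc hP ((hr.iff hP).2 hp))

theorem Rlz.of_tEq {β δ : Type} {U : Ultrafilter (β → N)} (hU : OnM M U) {c c' : δ → N}
    {h h' : β → N} (hr : Rlz M U c h) (hc : TEq M (Sum.elim h c) (Sum.elim h' c')) :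
    Rlz M U c' h' := by
  intro s hs h1
  have h2 : TEq M c c' := hc.pre Sum.inr (fun _ => rfl) (fun _ => rfl)
  exact hc _ hs (hr _ hs (hU.inv h2.symm hs h1))

/-! ### Morley sequences -/

theorem exists_rec_seq {X : Type*} (R : ∀ l : ℕ, (Fin l → X) → X → Prop)
    (h : ∀ l p, ∃ x, R l p x) : ∃ e : ℕ → X, ∀ l, R l (fun i => e i) (e l) := by
  choose f hf using h
  let F : ∀ l : ℕ, (∀ m : ℕ, m < l → X) → X := fun l g => f l (fun i => g i i.2)
  refine ⟨WellFounded.fix (wellFounded_lt (α := ℕ)) F, fun l => ?_⟩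
  have := WellFounded.fix_eq (wellFounded_lt (α := ℕ)) F l
  have h2 := hf l (fun i => WellFounded.fix (wellFounded_lt (α := ℕ)) F i)
  rw [this]
  exact h2

/-- initial segment of a sequence as a tuple -/
def pfx {β : Type} (n : ℕ) (e : ℕ → β → N) : Fin n × β → N := fun q => e q.1 q.2

variable (M) in
/-- Morley sequences of `U` over `M c`, of length `n` -/
def Morley {β δ : Type} (U : Ultrafilter (β → N)) (c : δ → N) (n : ℕ) (e : ℕ → β → N) : Prop :=
  ∀ l < n, Rlz M U (Sum.elim (pfx l e) c) (e l)

theorem SatP.exists_morley (H : SatP M) {β δ : Type} [Finite β] [Finite δ]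
    (U : Ultrafilter (β → N)) (c : δ → N) : ∃ e, ∀ n, Morley M U c n e := by
  obtain ⟨e, he⟩ := exists_rec_seq
    (fun l (p : Fin l → β → N) x => Rlz M U (Sum.elim (fun q : Fin l × β => p q.1 q.2) c) x)
    (fun l p => H.exists_rlz U _)
  exact ⟨e, fun n l _ => he l⟩

theorem Morley.tEq {β δ : Type} {U : Ultrafilter (β → N)} (hU : OnM M U) {c c' : δ → N}
    {n : ℕ} {e e' : ℕ → β → N} (he : Morley M U c n e) (he' : Morley M U c' n e')
    (hc : TEq M c c') : TEq M (Sum.elim (pfx n e) c) (Sum.elim (pfx n e') c') := by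
  induction n with
  | zero =>
    exact hc.pre (Sum.elim (fun q => q.1.elim0) id)
      (by rintro (⟨i, _⟩ | i); exact i.elim0; rfl) (by rintro (⟨i, _⟩ | i); exact i.elim0; rfl)
  | succ n ih =>
    have h1 := ih (fun l hl => he l (by omega)) (fun l hl => he' l (by omega))
    have h2 := (he n (by omega)).tEq hU (he' n (by omega)) h1
    have aux : ∀ (e : ℕ → β → N) (c : δ → N) (i : (Fin (n + 1) × β) ⊕ δ),
        Sum.elim (pfx (n + 1) e) c i = Sum.elim (e n) (Sum.elim (pfx n e) c)
          ((Sum.elim (fun q : Fin (n + 1) × β => if h : (q.1 : ℕ) < n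
            then (Sum.inr (Sum.inl (⟨q.1, h⟩, q.2)) : β ⊕ ((Fin n × β) ⊕ δ)) else Sum.inl q.2)
            (fun i => Sum.inr (Sum.inr i))) i) := by
      intro e c i
      rcases i with ⟨i, y⟩ | i
      · by_cases h : (i : ℕ) < n
        · simp [pfx, h]
        · have : (i : ℕ) = n := by omega
          simp [pfx, this]
      · rfl
    exact h2.pre _ (aux e c) (aux e' c')

theorem Morley.sub {β δ δ' : Type} {U : Ultrafilter (β → N)} {c : δ → N} {c' : δ' → N}
    {n m : ℕ} {e e' : ℕ → β → N} (he : Morley M U c n e) (σ : ℕ → ℕ) (τ : δ' → (ℕ × β) ⊕ δ)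
    (k : ℕ)
    (hσ : ∀ i j, i < j → j < m → σ i < σ j) (hσn : ∀ i < m, σ i < n)
    (hk : ∀ i < m, k ≤ σ i) (hτ : ∀ i q, τ i = Sum.inl q → q.1 < k)
    (hc : ∀ i, c' i = Sum.elim (fun q : ℕ × β => e q.1 q.2) c (τ i))
    (hee : ∀ i < m, e' i = e (σ i)) : Morley M U c' m e' := by
  intro l hl
  rw [hee l hl]
  have key : ∀ i : (Fin l × β) ⊕ δ', ∃ j : (Fin (σ l) × β) ⊕ δ,
      Sum.elim (pfx l e') c' i = Sum.elim (pfx (σ l) e) c j := by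
    rintro (⟨i, y⟩ | i)
    · refine ⟨Sum.inl (⟨σ i, hσ _ _ i.2 hl⟩, y), ?_⟩
      simp [pfx, hee i (i.2.trans hl)]
    · rcases h : τ i with q | q
      · refine ⟨Sum.inl (⟨q.1, (hτ i q h).trans_le (hk l hl)⟩, q.2), ?_⟩
        simp [pfx, hc, h]
      · refine ⟨Sum.inr q, ?_⟩
        simp [hc, h]
  choose ρ hρ using key
  exact (he (σ l) (hσn l hl)).restrict ρ hρ

/-! ### Independence -/

variable (M) in
/-- `tp(c / M e)` is finitely satisfiable in `M` -/
def Indep {γ δ : Type} (c : γ → N) (e : δ → N) : Prop :=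
  ∀ s : (γ ⊕ δ → N) → Prop, MDef M s → s (Sum.elim c e) → ∃ m, MPt M m ∧ s (Sum.elim m e)

theorem Rlz.indep {β δ : Type} {U : Ultrafilter (β → N)} (hU : OnM M U) {c : δ → N} {h : β → N}
    (hr : Rlz M U c h) : Indep M h c := by
  intro s hs h1
  obtain ⟨m, h2, h3⟩ := (hU.and ((hr.iff hs).2 h1)).exists
  exact ⟨m, h2, h3⟩

theorem Indep.exists_ultra {γ δ : Type} {c : γ → N} {e : δ → N} (h : Indep M c e) :
    ∃ V : Ultrafilter (γ → N), OnM M V ∧ Rlz M V e c := by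
  let F : Filter (γ → N) :=
    { sets := fun S => ∃ s : (γ ⊕ δ → N) → Prop, MDef M s ∧ s (Sum.elim c e) ∧
        ∀ m, MPt M m → s (Sum.elim m e) → m ∈ S
      univ_sets := ⟨fun _ => True, MDef.true, trivial, fun _ _ _ => trivial⟩
      sets_of_superset := fun ⟨s, h1, h2, h3⟩ hxy => ⟨s, h1, h2, fun m hm hs => hxy (h3 m hm hs)⟩
      inter_sets := fun ⟨s, h1, h2, h3⟩ ⟨s', h1', h2', h3'⟩ =>
        ⟨fun x => s x ∧ s' x, h1.and h1', ⟨h2, h2'⟩,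
          fun m hm hs => ⟨h3 m hm hs.1, h3' m hm hs.2⟩⟩ }
  have hF : ∀ S, S ∈ F ↔ ∃ s : (γ ⊕ δ → N) → Prop, MDef M s ∧ s (Sum.elim c e) ∧
        ∀ m, MPt M m → s (Sum.elim m e) → m ∈ S := fun S => Iff.rfl
  have : F.NeBot := by
    refine ⟨fun hb => ?_⟩
    obtain ⟨s, h1, h2, h3⟩ := (hF ∅).1 (by rw [hb]; trivial)
    obtain ⟨m, hm, hm2⟩ := h s h1 h2
    exact h3 m hm hm2
  refine ⟨Ultrafilter.of F, ?_, ?_⟩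
  · apply Ultrafilter.of_le F
    exact ⟨fun _ => True, MDef.true, trivial, fun m hm _ => hm⟩
  · intro s hs h1
    by_contra h2
    have h3 : ∀ᶠ m in F, ¬ (¬ ¬ s (Sum.elim m e) ∧ MPt M m) :=
      ⟨fun x => ¬ s x, hs.not, h2, fun m hm hs => fun h => h.1 hs⟩
    have h4 := Ultrafilter.of_le F h3
    have h5 : ∀ᶠ m in (Ultrafilter.of F : Filter (γ → N)), MPt M m :=
      Ultrafilter.of_le F ⟨fun _ => True, MDef.true, trivial, fun m hm _ => hm⟩
    obtain ⟨m, hm⟩ := (h1.and (h5.and h4)).exists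
    exact hm.2.2 ⟨not_not.2 hm.1, hm.2.1⟩

theorem Indep.tEq {γ δ : Type} {c c' : γ → N} {e e' : δ → N} (h : Indep M c e)
    (ht : TEq M (Sum.elim c e) (Sum.elim c' e')) : Indep M c' e' := by
  intro s hs h1
  obtain ⟨m, hm, h2⟩ := h s hs (ht.symm _ hs h1)
  have h3 : TEq M e e' := ht.pre Sum.inr (fun _ => rfl) (fun _ => rfl)
  exact ⟨m, hm, h3 _ (hs.fixl hm) h2⟩

theorem Indep.pre {γ δ γ' δ' : Type} {c : γ → N} {e : δ → N} (h : Indep M c e)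
    (σ : γ' → γ) (τ : δ' → δ) {c' : γ' → N} {e' : δ' → N} (hc : ∀ i, c' i = c (σ i))
    (he : ∀ i, e' i = e (τ i)) : Indep M c' e' := by
  obtain rfl : c' = c ∘ σ := funext hc
  obtain rfl : e' = e ∘ τ := funext he
  intro s hs h1
  have hd : MDef M (fun x : γ ⊕ δ → N => s (Sum.elim (fun i => x (Sum.inl (σ i)))
      (fun i => x (Sum.inr (τ i))))) :=
    hs.pre _ (Sum.map σ τ) (fun x i => by cases i <;> rfl)
  obtain ⟨m, hm, h2⟩ := h _ hd h1
  exact ⟨m ∘ σ, fun i => hm _, h2⟩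

theorem Indep.ltrans {γ δ ζ : Type} {c : γ → N} {e₁ : δ → N} {e₂ : ζ → N}
    (h : Indep M c (Sum.elim e₁ e₂)) (h' : Indep M e₁ e₂) : Indep M (Sum.elim c e₁) e₂ := by
  intro s hs h1
  have hd : MDef M (fun x : γ ⊕ (δ ⊕ ζ) → N => s (Sum.elim (Sum.elim (fun i => x (Sum.inl i))
      (fun i => x (Sum.inr (Sum.inl i)))) (fun i => x (Sum.inr (Sum.inr i))))) :=
    hs.pre _ (Sum.elim (Sum.elim Sum.inl (fun i => Sum.inr (Sum.inl i)))
      (fun i => Sum.inr (Sum.inr i))) (fun x i => by rcases i with (i | i) | i <;> rfl)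
  obtain ⟨m, hm, h2⟩ := h _ hd h1
  obtain ⟨m', hm', h3⟩ := h' _ (hd.fixl hm) h2
  exact ⟨Sum.elim m m', fun i => by cases i; exact hm _; exact hm' _, h3⟩

end Helpers2

section Helpers3

variable {L : FirstOrder.Language.{u, v}} {N : Type w} [L.Structure N]
variable {M : L.ElementarySubstructure N}

/-! ### NIP, semantically -/

variable (M) in
/-- every `M`-definable relation has bounded independence -/
def NIPsem : Prop := ∀ (ξ β : Type) [Finite ξ] [Finite β] (s : (ξ ⊕ β → N) → Prop), MDef M s →
  ∃ K : ℕ, ¬ ∃ (y : Fin K → β → N) (x : Set (Fin K) → ξ → N),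
    ∀ i S, s (Sum.elim (x S) (y i)) ↔ i ∈ S

theorem nipsem_of (hnip : IsNIP L N) [hN : Nonempty N] : NIPsem M := by
  intro ξ β _ _ s hs
  classical
  by_contra hcon
  push Not at hcon
  choose y x hyx using hcon
  obtain ⟨ψ, hψ⟩ := hs
  obtain ⟨p, ψ', m, hm⟩ := formula_support ψ
  obtain ⟨n₁, ⟨e₁⟩⟩ := Finite.exists_equiv_fin β
  obtain ⟨n₂, ⟨e₂⟩⟩ := Finite.exists_equiv_fin (ξ ⊕ Fin p)
  let φ : L.Formula (Fin n₁ ⊕ Fin n₂) := ψ'.relabel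
    (Sum.elim (Sum.elim (fun i => Sum.inr (e₂ (Sum.inl i))) (fun i => Sum.inl (e₁ i)))
      (fun i => Sum.inr (e₂ (Sum.inr i))))
  have hφ : ∀ (y : β → N) (x : ξ → N), φ.Realize (Sum.elim (y ∘ e₁.symm)
      (Sum.elim x (fun i => (m i : N)) ∘ e₂.symm)) ↔ s (Sum.elim x y) := by
    intro y x
    rw [← hψ, ← hm N _ ((↑) : M → N), Formula.realize_relabel]
    apply iff_of_eq; congr 1
    funext i; rcases i with (i | i) | i <;> simp
  let U : Ultrafilter (ULift.{w} ℕ) := (Filter.hyperfilter ℕ).map ULift.up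
  obtain ⟨E, cls, hemb, hlos⟩ := exists_ultraExt (L := L) (N := N) U
  have hne : Nonempty E.Carrier := ⟨E.emb (Classical.arbitrary N)⟩
  have hmod : E.Carrier ⊨ L.completeTheory N := by
    have h1 : N ≅[L] E.Carrier := E.emb.elementarilyEquivalent
    exact (h1.theory_model_iff (T := L.completeTheory N)).1 inferInstance
  let a : ℕ → Fin n₁ → ULift.{w} ℕ → N := fun i q K =>
    if h : i < K.down then y K.down ⟨i, h⟩ (e₁.symm q) else Classical.arbitrary N
  let bS : Set ℕ → Fin n₂ → ULift.{w} ℕ → N := fun S q K =>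
    Sum.elim (x K.down {i | (i : ℕ) ∈ S}) (fun i => (m i : N)) (e₂.symm q)
  refine hnip n₁ n₂ φ ⟨Theory.ModelType.of (L.completeTheory N) E.Carrier,
    fun i q => cls (a i q), fun S q => cls (bS S q), ?_⟩
  intro i S
  have h1 := hlos (Fin n₁ ⊕ Fin n₂) φ (Sum.elim (a i) (bS S))
  have h2 : (fun j => cls (Sum.elim (a i) (bS S) j)) =
      Sum.elim (fun q => cls (a i q)) (fun q => cls (bS S q)) := by
    funext j; cases j <;> rfl
  rw [h2] at h1
  refine h1.trans ?_
  have h3 : ∀ᶠ K in (U : Filter (ULift.{w} ℕ)), i < K.down := by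
    show ∀ᶠ K in ((Filter.hyperfilter ℕ : Ultrafilter ℕ) : Filter ℕ), i < K
    apply Nat.hyperfilter_le_atTop
    exact Filter.eventually_gt_atTop i
  have h4 : ∀ᶠ K in (U : Filter (ULift.{w} ℕ)),
      (φ.Realize (fun j => Sum.elim (a i) (bS S) j K) ↔ i ∈ S) := by
    filter_upwards [h3] with K hK
    have h5 : (fun j => Sum.elim (a i) (bS S) j K) = Sum.elim (y K.down ⟨i, hK⟩ ∘ e₁.symm)
      (Sum.elim (x K.down {i | (i : ℕ) ∈ S}) (fun i => (m i : N)) ∘ e₂.symm) := by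
      funext j; cases j <;> simp [a, bS, hK]
    rw [h5, hφ, hyx]
    simp
  rw [Filter.eventually_congr h4]
  simp

theorem SatP.alternation (H : SatP M) {ξ β ζ : Type} [Finite ξ] [Finite β] [Finite ζ]
    {s : (ξ ⊕ β → N) → Prop} (hs : MDef M s) {K : ℕ}
    (hK : ¬ ∃ (y : Fin K → β → N) (x : Set (Fin K) → ξ → N),
      ∀ i S, s (Sum.elim (x S) (y i)) ↔ i ∈ S)
    {U : Ultrafilter (β → N)} (hU : OnM M U) (z : ℕ → ζ → N) (σ τ : β → ζ)
    (hg : ∀ l < K, Rlz M U (pfx l z) (z l ∘ σ)) (hh : ∀ l < K, Rlz M U (pfx l z) (z l ∘ τ))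
    (a : ξ → N) :
    ¬ ∀ l < K, ¬ (s (Sum.elim a (z l ∘ σ)) ↔ s (Sum.elim a (z l ∘ τ))) := by
  classical
  intro ha
  apply hK
  have hgen : ∀ ρ : ℕ → β → ζ, (∀ l, ρ l = σ ∨ ρ l = τ) →
      Morley M U (Empty.elim : Empty → N) K (fun l => z l ∘ ρ l) := by
    intro ρ hρ l hl
    have h1 : Rlz M U (pfx l z) (z l ∘ ρ l) := by
      rcases hρ l with h | h <;> rw [h]
      · exact hg l hl
      · exact hh l hl
    refine h1.restrict (Sum.elim (fun q => (q.1, ρ q.1 q.2)) Empty.elim) ?_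
    rintro (i | i)
    · rfl
    · exact i.elim
  have hx : ∀ S : Set (Fin K), ∃ x : ξ → N, ∀ i : Fin K,
      s (Sum.elim x (z i ∘ σ)) ↔ i ∈ S := by
    intro S
    let ρ : ℕ → β → ζ := fun l => if ((∃ h : l < K, (⟨l, h⟩ : Fin K) ∈ S) ↔
      s (Sum.elim a (z l ∘ σ))) then σ else τ
    have hρ : ∀ l, ρ l = σ ∨ ρ l = τ := by
      intro l; simp only [ρ]; split_ifs <;> simp
    have h1 := (hgen ρ hρ).tEq hU (hgen (fun _ => σ) (fun _ => Or.inl rfl)) (TEq.refl _)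
    obtain ⟨x, hx⟩ := H.homog h1 a
    refine ⟨x, fun i => ?_⟩
    have h2 : TEq M (Sum.elim a (z i ∘ ρ i)) (Sum.elim x (z i ∘ σ)) := by
      refine hx.pre (Sum.map id (fun q => Sum.inl (i, q))) ?_ ?_
      · rintro (j | j) <;> rfl
      · rintro (j | j) <;> rfl
    rw [← h2.iff hs]
    have h3 := ha i i.2
    have h4 : (∃ h : (i : ℕ) < K, (⟨i, h⟩ : Fin K) ∈ S) ↔ i ∈ S := by simp
    by_cases hc : ((∃ h : (i : ℕ) < K, (⟨i, h⟩ : Fin K) ∈ S) ↔ s (Sum.elim a (z i ∘ σ)))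
    · have : ρ i = σ := if_pos hc
      rw [this, ← hc, h4]
    · have : ρ i = τ := if_neg hc
      rw [this]
      rw [h4] at hc
      tauto
  choose x hx using hx
  exact ⟨fun i => z i ∘ σ, x, fun i S => hx S i⟩

/-! ### Invariant filters and the broom lemma -/

variable (M) in
/-- invariance of a filter over `M` -/
def FInv {ξ : Type} (F : Filter (ξ → N)) : Prop :=
  ∀ (δ : Type) [Finite δ] (s : (ξ ⊕ δ → N) → Prop), MDef M s → ∀ g g' : δ → N, TEq M g g' →
    (∀ᶠ a in F, s (Sum.elim a g)) → ∀ᶠ a in F, s (Sum.elim a g')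

variable (M) in
/-- `A(x, f)` is negligible -/
def Neg {ξ δ : Type} (F : Filter (ξ → N)) (A : (ξ ⊕ δ → N) → Prop) (f : δ → N) : Prop :=
  ∀ (γ : Type) [Finite γ] (ψ : (ξ ⊕ γ → N) → Prop) (c : γ → N), MDef M ψ → Indep M c f →
    (∀ᶠ a in F, ψ (Sum.elim a c) ∨ A (Sum.elim a f)) → ∀ᶠ a in F, ψ (Sum.elim a c)

theorem MDef.lmap {ξ δ δ' : Type*} {s : (ξ ⊕ δ → N) → Prop} (hs : MDef M s) (σ : δ → δ') :
    MDef M (fun x : ξ ⊕ δ' → N => s (Sum.elim (fun i => x (Sum.inl i))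
      (fun i => x (Sum.inr (σ i))))) :=
  hs.pre _ (Sum.map id σ) (fun x i => by cases i <;> rfl)

theorem Neg.inv (H : SatP M) {ξ δ : Type} [Finite δ] {F : Filter (ξ → N)} (hF : FInv M F)
    {A : (ξ ⊕ δ → N) → Prop} (hA : MDef M A) {f f' : δ → N} (h : TEq M f f')
    (hn : Neg M F A f) : Neg M F A f' := by
  intro γ _ ψ c hψ hi hev
  obtain ⟨c', hc'⟩ := H.homog h.symm c
  have h1 := hF _ _ ((hψ.lmap (Sum.inl : γ → γ ⊕ δ)).or (hA.lmap (Sum.inr : δ → γ ⊕ δ))) _ _ hc' hev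
  have h2 := hn γ ψ c' hψ (hi.tEq hc') h1
  exact hF _ _ hψ _ _ (hc'.symm.pre Sum.inl (fun _ => rfl) (fun _ => rfl)) h2

theorem Neg.removal {ξ ζ : Type} [Finite ζ] {F : Filter (ξ → N)}
    {B : (ξ ⊕ ζ → N) → Prop} (hB : MDef M B) (z : ℕ → ζ → N) (K : ℕ)
    (hz : ∀ l < K, Indep M (z l) (pfx l z)) (hn : ∀ l < K, Neg M F B (z l))
    (γ : Type) [Finite γ] (ψ : (ξ ⊕ γ → N) → Prop) (c : γ → N) (hψ : MDef M ψ)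
    (hc : Indep M c (pfx K z))
    (hev : ∀ᶠ a in F, ψ (Sum.elim a c) ∨ ∃ l, l < K ∧ B (Sum.elim a (z l))) :
    ∀ᶠ a in F, ψ (Sum.elim a c) := by
  induction K generalizing γ ψ c with
  | zero => filter_upwards [hev] with a ha; simpa using ha
  | succ K ih =>
    have h1 : Indep M c (Sum.elim (z K) (pfx K z)) := by
      refine hc.pre id (Sum.elim (fun i => (⟨K, by omega⟩, i))
        (fun q => (⟨q.1, by omega⟩, q.2))) (fun _ => rfl) ?_
      rintro (i | i) <;> rfl
    have h2 := ih (fun l hl => hz l (by omega)) (fun l hl => hn l (by omega)) (γ ⊕ ζ) _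
      (Sum.elim c (z K))
      ((hψ.lmap (Sum.inl : γ → γ ⊕ ζ)).or (hB.lmap (Sum.inr : ζ → γ ⊕ ζ)))
      (h1.ltrans (hz K (by omega))) (by
        filter_upwards [hev] with a ha
        rcases ha with ha | ⟨l, hl, ha⟩
        · exact Or.inl (Or.inl ha)
        · rcases Nat.lt_succ_iff_lt_or_eq.1 hl with h | rfl
          · exact Or.inr ⟨l, h, ha⟩
          · exact Or.inl (Or.inr ha))
    refine hn K (by omega) γ ψ c hψ ?_ h2
    exact h1.pre id Sum.inl (fun _ => rfl) (fun _ => rfl)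

theorem exists_joint_ultra {δ β : Type} [Finite δ] [Finite β] {f : δ → N} {g h : β → N}
    {U : Ultrafilter (β → N)} (hU : OnM M U) (hg : Rlz M U (Empty.elim : Empty → N) g)
    (hh : Rlz M U g h) :
    ∃ t : Ultrafilter (δ ⊕ (β ⊕ β) → N), OnM M t ∧
      (∀ s : (δ ⊕ (β ⊕ β) → N) → Prop, MDef M s → s (Sum.elim f (Sum.elim g h)) →
        ∀ᶠ z in (t : Filter (δ ⊕ (β ⊕ β) → N)), s z) ∧
      (∀ S : (β → N) → Prop, (∀ᶠ m in (U : Filter (β → N)), S m) →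
        ∀ᶠ z in (t : Filter (δ ⊕ (β ⊕ β) → N)), S (fun i => z (Sum.inr (Sum.inl i)))) ∧
      (∀ S : (β → N) → Prop, (∀ᶠ m in (U : Filter (β → N)), S m) →
        ∀ᶠ z in (t : Filter (δ ⊕ (β ⊕ β) → N)), S (fun i => z (Sum.inr (Sum.inr i)))) := by
  let F : Filter (δ ⊕ (β ⊕ β) → N) :=
    { sets := fun T => ∃ s : (δ ⊕ (β ⊕ β) → N) → Prop, MDef M s ∧
        s (Sum.elim f (Sum.elim g h)) ∧ ∃ S : (β → N) → Prop,
          (∀ᶠ m in (U : Filter (β → N)), S m) ∧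
          ∀ z, MPt M z → s z → S (fun i => z (Sum.inr (Sum.inl i))) →
            S (fun i => z (Sum.inr (Sum.inr i))) → z ∈ T
      univ_sets := ⟨fun _ => True, MDef.true, trivial, fun _ => True, by simp,
        fun _ _ _ _ _ => trivial⟩
      sets_of_superset := fun ⟨s, h1, h2, S, h3, h4⟩ hxy =>
        ⟨s, h1, h2, S, h3, fun z a b c d => hxy (h4 z a b c d)⟩
      inter_sets := fun ⟨s, h1, h2, S, h3, h4⟩ ⟨s', h1', h2', S', h3', h4'⟩ =>
        ⟨fun x => s x ∧ s' x, h1.and h1', ⟨h2, h2'⟩, fun m => S m ∧ S' m, h3.and h3',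
          fun z a b c d => ⟨h4 z a b.1 c.1 d.1, h4' z a b.2 c.2 d.2⟩⟩ }
  have hF : ∀ T, T ∈ F ↔ ∃ s : (δ ⊕ (β ⊕ β) → N) → Prop, MDef M s ∧
        s (Sum.elim f (Sum.elim g h)) ∧ ∃ S : (β → N) → Prop,
          (∀ᶠ m in (U : Filter (β → N)), S m) ∧
          ∀ z, MPt M z → s z → S (fun i => z (Sum.inr (Sum.inl i))) →
            S (fun i => z (Sum.inr (Sum.inr i))) → z ∈ T := fun T => Iff.rfl
  have : F.NeBot := by
    refine ⟨fun hb => ?_⟩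
    obtain ⟨s, h1, h2, S, h3, h4⟩ := (hF ∅).1 (by rw [hb]; trivial)
    have d1 : MDef M (fun y : β ⊕ β → N => ∃ x : δ → N, s (Sum.elim x y)) := h1.exl
    have d2 : MDef M (fun y : β ⊕ β → N => ∃ x : δ → N, s (Sum.elim x
        (Sum.elim (fun i => y (Sum.inr i)) (fun i => y (Sum.inl i))))) :=
      d1.pre _ (Sum.elim Sum.inr Sum.inl) (fun x i => by cases i <;> rfl)
    have e1 := (hh.iff d2).2 ⟨f, h2⟩
    obtain ⟨m, ⟨hm, hS⟩, he1⟩ := ((hU.and h3).and e1).exists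
    have d3 : MDef M (fun y : β → N => ∃ x : δ → N, s (Sum.elim x (Sum.elim y m))) :=
      d2.fixl hm
    have d4 : MDef M (fun y : β ⊕ Empty → N => ∃ x : δ → N, s (Sum.elim x
        (Sum.elim (fun i => y (Sum.inl i)) m))) :=
      d3.pre _ Sum.inl (fun x i => rfl)
    have e2 := (hg.iff d4).2 he1
    obtain ⟨m', ⟨hm', hS'⟩, he2⟩ := ((hU.and h3).and e2).exists
    have hp : MPt M (Sum.elim m' m) := by
      rintro (i | i)
      · exact hm' i
      · exact hm i
    obtain ⟨x, hx, hx'⟩ := (h1.fixr hp).exists_mpt he2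
    refine h4 (Sum.elim x (Sum.elim m' m)) ?_ hx hS' hS
    rintro (i | i)
    · exact hx' i
    · exact hp i
  refine ⟨Ultrafilter.of F, ?_, ?_, ?_, ?_⟩
  · apply Ultrafilter.of_le F
    exact ⟨fun _ => True, MDef.true, trivial, fun _ => True, by simp, fun z hz _ _ _ => hz⟩
  · intro s hs h1
    apply Ultrafilter.of_le F
    exact ⟨s, hs, h1, fun _ => True, by simp, fun z _ hz _ _ => hz⟩
  · intro S hS
    apply Ultrafilter.of_le F
    exact ⟨fun _ => True, MDef.true, trivial, S, hS, fun z _ _ hz _ => hz⟩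
  · intro S hS
    apply Ultrafilter.of_le F
    exact ⟨fun _ => True, MDef.true, trivial, S, hS, fun z _ _ _ hz => hz⟩

theorem Neg.key (H : SatP M) (hN : NIPsem M) {ξ δ β : Type} [Finite ξ] [Finite δ] [Finite β]
    {F : Filter (ξ → N)} (hF : FInv M F) {A : (ξ ⊕ δ → N) → Prop} (hA : MDef M A) {f : δ → N}
    (hn : Neg M F A f) {s : (ξ ⊕ β → N) → Prop} (hs : MDef M s)
    {U : Ultrafilter (β → N)} (hU : OnM M U) {g h : β → N}
    (hg : Rlz M U (Empty.elim : Empty → N) g) (hh : Rlz M U g h) :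
    ∃ A' : (ξ ⊕ (δ ⊕ (β ⊕ β)) → N) → Prop, MDef M A' ∧
      Neg M F A' (Sum.elim f (Sum.elim g h)) ∧
      ∀ a, (A (Sum.elim a f) ∨ ¬ (s (Sum.elim a g) ↔ s (Sum.elim a h))) →
        A' (Sum.elim a (Sum.elim f (Sum.elim g h))) := by
  have dA := hA.lmap (Sum.inl : δ → δ ⊕ (β ⊕ β))
  have dD := ((hs.lmap (fun i : β => (Sum.inr (Sum.inl i) : δ ⊕ (β ⊕ β)))).iff
    (hs.lmap (fun i : β => (Sum.inr (Sum.inr i) : δ ⊕ (β ⊕ β))))).not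
  refine ⟨_, dA.or dD, ?_, fun a ha => ha⟩
  intro γ _ ψ c hψ hc hev
  obtain ⟨V, hV, hVc⟩ := hc.exists_ultra
  obtain ⟨t, ht, ht1, ht2, ht3⟩ := exists_joint_ultra (f := f) hU hg hh
  obtain ⟨z, hz⟩ := H.exists_morley t (Empty.elim : Empty → N)
  obtain ⟨K, hK⟩ := hN ξ β s hs
  have hzr : ∀ l, Rlz M t (pfx l z) (z l) := fun l =>
    (hz (l + 1) l (by omega)).restrict Sum.inl (fun _ => rfl)
  have hzt : ∀ l, TEq M (Sum.elim f (Sum.elim g h)) (z l) := by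
    intro l P hP hp
    have d : MDef M (fun x : (δ ⊕ (β ⊕ β)) ⊕ (Fin l × (δ ⊕ (β ⊕ β))) → N =>
      P (fun i => x (Sum.inl i))) := hP.pre _ Sum.inl (fun _ _ => rfl)
    exact hzr l _ d (ht1 P hP hp)
  obtain ⟨c', hc'⟩ := H.exists_rlz V (pfx K z)
  have hcz : ∀ l < K, TEq M (Sum.elim c (Sum.elim f (Sum.elim g h))) (Sum.elim c' (z l)) := by
    intro l hl
    exact hVc.tEq hV (hc'.restrict (fun i => (⟨l, hl⟩, i)) (fun _ => rfl)) (hzt l)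
  have hev2 : ∀ l : Fin K, ∀ᶠ a in F, ψ (Sum.elim a c') ∨ A (Sum.elim a (z l ∘ Sum.inl)) ∨
      ¬ (s (Sum.elim a (z l ∘ (Sum.inr ∘ Sum.inl))) ↔
        s (Sum.elim a (z l ∘ (Sum.inr ∘ Sum.inr)))) := by
    intro l
    exact hF _ _ ((hψ.lmap (Sum.inl : γ → γ ⊕ (δ ⊕ (β ⊕ β)))).or
      ((dA.or dD).lmap (Sum.inr : (δ ⊕ (β ⊕ β)) → γ ⊕ (δ ⊕ (β ⊕ β))))) _ _ (hcz l l.2) hev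
  rw [← Filter.eventually_all] at hev2
  have halt := H.alternation hs hK hU z (fun i => Sum.inr (Sum.inl i)) (fun i => Sum.inr (Sum.inr i))
    (by
      intro l _ S hS hS2
      have d : MDef M (fun x : (δ ⊕ (β ⊕ β)) ⊕ (Fin l × (δ ⊕ (β ⊕ β))) → N =>
        S (Sum.elim (fun i => x (Sum.inl (Sum.inr (Sum.inl i)))) (fun i => x (Sum.inr i)))) :=
        hS.pre _ (Sum.map (fun i => Sum.inr (Sum.inl i)) id) (fun x i => by cases i <;> rfl)
      exact hzr l _ d (ht2 _ hS2))
    (by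
      intro l _ S hS hS2
      have d : MDef M (fun x : (δ ⊕ (β ⊕ β)) ⊕ (Fin l × (δ ⊕ (β ⊕ β))) → N =>
        S (Sum.elim (fun i => x (Sum.inl (Sum.inr (Sum.inr i)))) (fun i => x (Sum.inr i)))) :=
        hS.pre _ (Sum.map (fun i => Sum.inr (Sum.inr i)) id) (fun x i => by cases i <;> rfl)
      exact hzr l _ d (ht3 _ hS2))
  have hev3 : ∀ᶠ a in F, ψ (Sum.elim a c') ∨ ∃ l, l < K ∧ A (Sum.elim a (z l ∘ Sum.inl)) := by
    filter_upwards [hev2] with a ha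
    by_contra hcon
    push Not at hcon
    refine halt a fun l hl => ?_
    rcases ha ⟨l, hl⟩ with h1 | h1 | h1
    · exact absurd h1 hcon.1
    · exact absurd h1 (hcon.2 l hl)
    · exact h1
  have hnz : ∀ l, Neg M F (fun x : ξ ⊕ (δ ⊕ (β ⊕ β)) → N => A (Sum.elim (fun i => x (Sum.inl i))
      (fun i => x (Sum.inr (Sum.inl i))))) (z l) := by
    intro l
    refine Neg.inv H hF dA (hzt l) ?_
    intro γ _ ψ c hψ hi he
    exact hn γ ψ c hψ (hi.pre id Sum.inl (fun _ => rfl) (fun _ => rfl)) he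
  have hfin := Neg.removal dA z K (fun l _ => (hzr l).indep ht) (fun l _ => hnz l) γ ψ c' hψ
    (hc'.indep hV) hev3
  refine hF _ _ hψ _ _ ?_ hfin
  have h0 : TEq M (fun i => i.elim : Empty → N) (fun i => i.elim) := TEq.refl _
  have r1 : Rlz M V (fun i => i.elim : Empty → N) c := hVc.restrict Empty.elim (fun i => i.elim)
  have r2 : Rlz M V (fun i => i.elim : Empty → N) c' := hc'.restrict Empty.elim (fun i => i.elim)
  exact (r2.tEq hV r1 h0).pre Sum.inl (fun _ => rfl) (fun _ => rfl)

variable (M) in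
/-- contained in a negligible definable set -/
def NegE {ξ : Type} (F : Filter (ξ → N)) (T : (ξ → N) → Prop) : Prop :=
  ∃ (δ : Type) (_ : Finite δ) (f : δ → N) (A : (ξ ⊕ δ → N) → Prop), MDef M A ∧ Neg M F A f ∧
    ∀ a, T a → A (Sum.elim a f)

variable (M) in
/-- strongly negligible -/
def SNeg {ξ : Type} (F : Filter (ξ → N)) (D : (ξ → N) → Prop) : Prop :=
  ∀ T, NegE M F T → NegE M F (fun a => T a ∨ D a)

theorem NegE.mono {ξ : Type} {F : Filter (ξ → N)} {T T' : (ξ → N) → Prop} (h : NegE M F T)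
    (hT : ∀ a, T' a → T a) : NegE M F T' := by
  obtain ⟨δ, hδ, f, A, h1, h2, h3⟩ := h
  exact ⟨δ, hδ, f, A, h1, h2, fun a ha => h3 a (hT a ha)⟩

theorem SNeg.or {ξ : Type} {F : Filter (ξ → N)} {D D' : (ξ → N) → Prop} (h : SNeg M F D)
    (h' : SNeg M F D') : SNeg M F (fun a => D a ∨ D' a) := fun T hT =>
  (h' _ (h T hT)).mono fun a ha => by tauto

theorem SNeg.mono {ξ : Type} {F : Filter (ξ → N)} {D D' : (ξ → N) → Prop} (h : SNeg M F D)
    (hT : ∀ a, D' a → D a) : SNeg M F D' := fun T hT' =>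
  (h T hT').mono fun a ha => ha.imp_right (hT a)

theorem sneg_key (H : SatP M) (hN : NIPsem M) {ξ β : Type} [Finite ξ] [Finite β]
    {F : Filter (ξ → N)} (hF : FInv M F) {s : (ξ ⊕ β → N) → Prop} (hs : MDef M s)
    {U : Ultrafilter (β → N)} (hU : OnM M U) {g h : β → N}
    (hg : Rlz M U (Empty.elim : Empty → N) g) (hh : Rlz M U g h) :
    SNeg M F (fun a => ¬ (s (Sum.elim a g) ↔ s (Sum.elim a h))) := by
  rintro T ⟨δ, hδ, f, A, h1, h2, h3⟩
  obtain ⟨A', h1', h2', h3'⟩ := Neg.key H hN hF h1 h2 hs hU hg hh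
  exact ⟨_, inferInstance, _, A', h1', h2', fun a ha => h3' a (ha.imp_left (h3 a))⟩

theorem exists_ultra_of_point {β : Type} [Finite β] (g : β → N) :
    ∃ U : Ultrafilter (β → N), OnM M U ∧ Rlz M U (Empty.elim : Empty → N) g := by
  have : Indep M g (Empty.elim : Empty → N) := by
    intro s hs h1
    have hp : MPt M (Empty.elim : Empty → N) := fun i => i.elim
    obtain ⟨m, h2, h3⟩ := (hs.fixr hp).exists_mpt ⟨g, h1⟩
    exact ⟨m, h3, h2⟩
  exact this.exists_ultra

theorem Rlz.of_tEq_empty {β : Type} {U : Ultrafilter (β → N)} (hU : OnM M U) {h h' : β → N}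
    (hr : Rlz M U (Empty.elim : Empty → N) h) (hc : TEq M h h') :
    Rlz M U (Empty.elim : Empty → N) h' := by
  refine hr.of_tEq hU (hc.pre (Sum.elim id Empty.elim) ?_ ?_)
  · rintro (i | i)
    · rfl
    · exact i.elim
  · rintro (i | i)
    · rfl
    · exact i.elim

theorem sneg_inv (H : SatP M) (hN : NIPsem M) {ξ β : Type} [Finite ξ] [Finite β]
    {F : Filter (ξ → N)} (hF : FInv M F) {s : (ξ ⊕ β → N) → Prop} (hs : MDef M s)
    {g g' : β → N} (h : TEq M g g') :
    SNeg M F (fun a => ¬ (s (Sum.elim a g) ↔ s (Sum.elim a g'))) := by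
  obtain ⟨U, hU, hg⟩ := exists_ultra_of_point (M := M) g
  have hg' := hg.of_tEq_empty hU h
  obtain ⟨k, hk⟩ := H.exists_rlz U (Sum.elim g g')
  have k1 := sneg_key H hN hF hs hU hg (hk.restrict Sum.inl (fun _ => rfl))
  have k2 := sneg_key H hN hF hs hU hg' (hk.restrict Sum.inr (fun _ => rfl))
  exact (k1.or k2).mono fun a ha => by tauto

theorem broom (H : SatP M) (hN : NIPsem M) {ξ : Type} [Finite ξ]
    (F : Filter (ξ → N)) [F.NeBot] (hF : FInv M F) :
    ∃ p : Ultrafilter (ξ → N), (p : Filter (ξ → N)) ≤ F ∧ FInv M (p : Filter (ξ → N)) := by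
  let G : Filter (ξ → N) :=
    { sets := fun S => ∃ D, SNeg M F D ∧ ∀ᶠ a in F, a ∈ S ∨ D a
      univ_sets := ⟨fun _ => False, fun T hT => hT.mono (by tauto), by simp⟩
      sets_of_superset := fun ⟨D, h1, h2⟩ hxy =>
        ⟨D, h1, h2.mono fun a ha => ha.imp_left (fun h => hxy h)⟩
      inter_sets := fun ⟨D, h1, h2⟩ ⟨D', h1', h2'⟩ =>
        ⟨_, h1.or h1', (h2.and h2').mono fun a ha => by
          rcases ha with ⟨h | h, h' | h'⟩
          · exact Or.inl ⟨h, h'⟩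
          · exact Or.inr (Or.inr h')
          · exact Or.inr (Or.inl h)
          · exact Or.inr (Or.inl h)⟩ }
  have hG : ∀ S, S ∈ G ↔ ∃ D, SNeg M F D ∧ ∀ᶠ a in F, a ∈ S ∨ D a := fun S => Iff.rfl
  have hfalse : SNeg M F (fun _ => False) := fun T hT => hT.mono (by tauto)
  have : G.NeBot := by
    refine ⟨fun hb => ?_⟩
    obtain ⟨D, h1, h2⟩ := (hG ∅).1 (by rw [hb]; trivial)
    have h0 : NegE M F (fun _ => False) := by
      refine ⟨Empty, inferInstance, Empty.elim, fun _ => False, MDef.false, ?_, fun a h => h⟩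
      intro γ _ ψ c hψ hi he
      simpa using he
    obtain ⟨δ, hδ, f, A, h3, h4, h5⟩ := h1 _ h0
    have := h4 Empty (fun _ => False) Empty.elim MDef.false
      (fun s hs h => ⟨Empty.elim, fun i => i.elim, h⟩)
      (h2.mono fun a ha => Or.inr (h5 a (Or.inr (ha.resolve_left (fun h => h)))))
    obtain ⟨a, ha⟩ := this.exists
    exact ha
  refine ⟨Ultrafilter.of G, (Ultrafilter.of_le G).trans ?_, ?_⟩
  · intro S hS
    exact ⟨_, hfalse, (show ∀ᶠ a in F, a ∈ S from hS).mono fun a ha => Or.inl ha⟩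
  · intro δ _ s hs g g' h h1
    have h2 : ∀ᶠ a in G, (s (Sum.elim a g) ↔ s (Sum.elim a g')) :=
      ⟨_, sneg_inv H hN hF hs h, Filter.Eventually.of_forall fun a => em _⟩
    have h3 := Ultrafilter.of_le G h2
    filter_upwards [h1, h3] with a ha1 ha2
    exact ha2.1 ha1

/-- the filter generated by the conjugates of `χ(x, b)` -/
def genF {ξ β : Type} (M : L.ElementarySubstructure N) (χ : (ξ ⊕ β → N) → Prop) (b : β → N) :
    Filter (ξ → N) where
  sets := fun S => ∃ (ι : Type) (_ : Finite ι) (B : ι → β → N), (∀ i, TEq M (B i) b) ∧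
    ∀ a, (∀ i, χ (Sum.elim a (B i))) → a ∈ S
  univ_sets := ⟨Empty, inferInstance, Empty.elim, fun i => i.elim, fun _ _ => trivial⟩
  sets_of_superset := fun ⟨ι, hι, B, h1, h2⟩ hxy => ⟨ι, hι, B, h1, fun a ha => hxy (h2 a ha)⟩
  inter_sets := fun ⟨ι, hι, B, h1, h2⟩ ⟨ι', hι', B', h1', h2'⟩ =>
    ⟨ι ⊕ ι', inferInstance, Sum.elim B B', fun i => by cases i; exact h1 _; exact h1' _,
      fun a ha => ⟨h2 a fun i => ha (Sum.inl i), h2' a fun i => ha (Sum.inr i)⟩⟩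

theorem mem_genF {ξ β : Type} {χ : (ξ ⊕ β → N) → Prop} {b : β → N} {S : Set (ξ → N)} :
    S ∈ genF M χ b ↔ ∃ (ι : Type) (_ : Finite ι) (B : ι → β → N), (∀ i, TEq M (B i) b) ∧
    ∀ a, (∀ i, χ (Sum.elim a (B i))) → a ∈ S := Iff.rfl

theorem genF_self {ξ β : Type} {χ : (ξ ⊕ β → N) → Prop} {b d : β → N} (h : TEq M d b) :
    ∀ᶠ a in genF M χ b, χ (Sum.elim a d) :=
  mem_genF.2 ⟨Unit, inferInstance, fun _ => d, fun _ => h, fun _ ha => ha ()⟩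

theorem genF_inv (H : SatP M) {ξ β : Type} [Finite ξ] [Finite β] {χ : (ξ ⊕ β → N) → Prop}
    (hχ : MDef M χ) (b : β → N) : FInv M (genF M χ b) := by
  intro δ _ s hs g g' hg hev
  obtain ⟨ι, hι, B, h1, h2⟩ := mem_genF.1 hev
  obtain ⟨B', hB'⟩ := H.homog hg (fun q : ι × β => B q.1 q.2)
  refine mem_genF.2 ⟨ι, hι, fun i j => B' (i, j), fun i => ?_, ?_⟩
  · refine TEq.trans ?_ (h1 i)
    exact hB'.symm.pre (fun j => Sum.inl (i, j)) (fun _ => rfl) (fun _ => rfl)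
  · have d1 : MDef M (fun x : ξ ⊕ ((ι × β) ⊕ δ) → N => (∀ i : ι, χ (Sum.elim
        (fun j => x (Sum.inl j)) (fun j => x (Sum.inr (Sum.inl (i, j)))))) →
        s (Sum.elim (fun j => x (Sum.inl j)) (fun j => x (Sum.inr (Sum.inr j))))) :=
      (MDef.forallFin fun i => hχ.lmap (fun j => Sum.inl (i, j))).imp (hs.lmap Sum.inr)
    exact hB' _ d1.alll h2

end Helpers3

section Helpers4

variable {L : FirstOrder.Language.{u, v}} {N : Type w} [L.Structure N]
variable {M : L.ElementarySubstructure N}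

/-! ### Strict coheirs -/

variable (M) in
/-- `χ(x, b)` lies in no invariant ultrafilter -/
def Bad {ζ β : Type} (b : β → N) (χ : (ζ ⊕ β → N) → Prop) : Prop :=
  ∀ p : Ultrafilter (ζ → N), FInv M (p : Filter (ζ → N)) →
    ¬ ∀ᶠ a in (p : Filter (ζ → N)), χ (Sum.elim a b)

theorem FInv.map {ζ ζ' : Type} {p : Ultrafilter (ζ → N)} (hp : FInv M (p : Filter (ζ → N)))
    (σ : ζ' → ζ) :
    FInv M ((p.map (fun x => x ∘ σ) : Ultrafilter (ζ' → N)) : Filter (ζ' → N)) := by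
  intro δ _ s hs g g' hg hev
  have d : MDef M (fun x : ζ ⊕ δ → N => s (Sum.elim (fun i => x (Sum.inl (σ i)))
      (fun i => x (Sum.inr i)))) :=
    hs.pre _ (Sum.map σ id) (fun x i => by cases i <;> rfl)
  exact hp _ _ d _ _ hg hev

theorem MDef.pair {ζ ζ' β : Type*} {χ : (ζ ⊕ β → N) → Prop} (h : MDef M χ) (σ : ζ → ζ') :
    MDef M (fun x : ζ' ⊕ β → N => χ (Sum.elim (fun i => x (Sum.inl (σ i)))
      (fun i => x (Sum.inr i)))) :=
  h.pre _ (Sum.map σ id) (fun x i => by cases i <;> rfl)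

theorem bad_or {ζ ζ' β : Type} {b : β → N} {χ : (ζ ⊕ β → N) → Prop} {χ' : (ζ' ⊕ β → N) → Prop}
    (h : Bad M b χ) (h' : Bad M b χ') :
    Bad M b (fun x : (ζ ⊕ ζ') ⊕ β → N =>
      χ (Sum.elim (fun i => x (Sum.inl (Sum.inl i))) (fun i => x (Sum.inr i))) ∨
      χ' (Sum.elim (fun i => x (Sum.inl (Sum.inr i))) (fun i => x (Sum.inr i)))) := by
  intro p hp hev
  rw [Ultrafilter.eventually_or] at hev
  rcases hev with hev | hev
  · exact h _ (hp.map Sum.inl) hev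
  · exact h' _ (hp.map Sum.inr) hev

theorem exists_strict (H : SatP M) (hN : NIPsem M) {β : Type} [Finite β] (b : β → N) :
    ∃ U : Ultrafilter (β → N), OnM M U ∧ Rlz M U (Empty.elim : Empty → N) b ∧
      ∀ (ζ : Type) [Finite ζ] (e : ζ → N) (χ : (ζ ⊕ β → N) → Prop), MDef M χ →
        (∀ᶠ m in (U : Filter (β → N)), χ (Sum.elim e m)) →
        ∃ p : Ultrafilter (ζ → N), FInv M (p : Filter (ζ → N)) ∧
          ∀ᶠ a in (p : Filter (ζ → N)), χ (Sum.elim a b) := by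
  have bad_false : Bad M b (fun _ : Empty ⊕ β → N => False) := by
    intro p hp h
    obtain ⟨_, h⟩ := h.exists
    exact h
  let F : Filter (β → N) :=
    { sets := fun S => ∃ s : (β → N) → Prop, MDef M s ∧ s b ∧
        ∃ (ζ : Type) (_ : Finite ζ) (e : ζ → N) (χ : (ζ ⊕ β → N) → Prop), MDef M χ ∧ Bad M b χ ∧
          ∀ m, MPt M m → s m → m ∈ S ∨ χ (Sum.elim e m)
      univ_sets := ⟨fun _ => True, MDef.true, trivial, Empty, inferInstance, Empty.elim,
        fun _ => False, MDef.false, bad_false, fun _ _ _ => Or.inl trivial⟩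
      sets_of_superset := fun ⟨s, h1, h2, ζ, hζ, e, χ, h3, h4, h5⟩ hxy =>
        ⟨s, h1, h2, ζ, hζ, e, χ, h3, h4, fun m hm hs => (h5 m hm hs).imp_left (fun h => hxy h)⟩
      inter_sets := fun ⟨s, h1, h2, ζ, hζ, e, χ, h3, h4, h5⟩
          ⟨s', h1', h2', ζ', hζ', e', χ', h3', h4', h5'⟩ =>
        ⟨fun x => s x ∧ s' x, h1.and h1', ⟨h2, h2'⟩, ζ ⊕ ζ', inferInstance, Sum.elim e e', _,
          (h3.pair Sum.inl).or (h3'.pair Sum.inr), bad_or h4 h4', fun m hm hs => by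
            rcases h5 m hm hs.1 with h | h
            · rcases h5' m hm hs.2 with h' | h'
              · exact Or.inl ⟨h, h'⟩
              · exact Or.inr (Or.inr h')
            · exact Or.inr (Or.inl h)⟩ }
  have hF : ∀ S, S ∈ F ↔ ∃ s : (β → N) → Prop, MDef M s ∧ s b ∧
        ∃ (ζ : Type) (_ : Finite ζ) (e : ζ → N) (χ : (ζ ⊕ β → N) → Prop), MDef M χ ∧ Bad M b χ ∧
          ∀ m, MPt M m → s m → m ∈ S ∨ χ (Sum.elim e m) := fun S => Iff.rfl
  have : F.NeBot := by
    refine ⟨fun hb => ?_⟩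
    obtain ⟨s, h1, h2, ζ, hζ, e, χ, h3, h4, h5⟩ := (hF ∅).1 (by rw [hb]; trivial)
    have hbot : ∅ ∈ genF M χ b := by
      by_contra hne
      have : (genF M χ b).NeBot := ⟨fun h => hne (by rw [h]; trivial)⟩
      obtain ⟨p, hp, hp'⟩ := broom H hN (genF M χ b) (genF_inv H h3 b)
      exact h4 p hp' (hp (genF_self (TEq.refl b)))
    obtain ⟨ι, hι, B, hB, hB2⟩ := mem_genF.1 hbot
    have d1 : MDef M (fun y : ι × β → N => ∀ i, s (fun j => y (i, j))) :=
      MDef.forallFin fun i => h1.pre _ (fun j => (i, j)) (fun _ _ => rfl)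
    have d2 : MDef M (fun x : ζ ⊕ (ι × β) → N => ¬ ∀ i : ι, χ (Sum.elim
        (fun j => x (Sum.inl j)) (fun j => x (Sum.inr (i, j))))) :=
      (MDef.forallFin fun i => h3.lmap (fun j => (i, j))).not
    obtain ⟨y, ⟨hy1, hy2⟩, hy3⟩ := (d1.and d2.alll).exists_mpt
      ⟨fun q => B q.1 q.2, fun i => (hB i).symm s h1 h2, fun a h => hB2 a h⟩
    refine hy2 e fun i => ?_
    exact (h5 (fun j => y (i, j)) (fun j => hy3 _) (hy1 i)).resolve_left (fun h => h)
  refine ⟨Ultrafilter.of F, ?_, ?_, ?_⟩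
  · apply Ultrafilter.of_le F
    exact ⟨fun _ => True, MDef.true, trivial, Empty, inferInstance, Empty.elim,
        fun _ => False, MDef.false, bad_false, fun _ hm _ => Or.inl hm⟩
  · intro s hs h1
    by_contra h2
    have hp : MPt M (Empty.elim : Empty → N) := fun i => i.elim
    have h3 : ∀ᶠ m in F, ¬ s (Sum.elim m Empty.elim) :=
      ⟨_, (hs.fixr hp).not, h2, Empty, inferInstance, Empty.elim,
        fun _ => False, MDef.false, bad_false, fun _ _ h => Or.inl h⟩
    have h4 := Ultrafilter.of_le F h3
    obtain ⟨m, hm⟩ := (h1.and h4).exists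
    exact hm.2 hm.1
  · intro ζ _ e χ hχ hev
    by_contra hcon
    have hbad : Bad M b χ := fun p hp h => hcon ⟨p, hp, h⟩
    have h3 : ∀ᶠ m in F, ¬ χ (Sum.elim e m) :=
      ⟨fun _ => True, MDef.true, trivial, ζ, inferInstance, e, χ, hχ, hbad,
        fun m _ _ => (em (χ (Sum.elim e m))).symm⟩
    obtain ⟨m, hm⟩ := (hev.and (Ultrafilter.of_le F h3)).exists
    exact hm.2 hm.1

/-! ### Index ultrafilter -/

/-- iterated product ultrafilter -/
noncomputable def iterU : ∀ n : ℕ, Ultrafilter (Fin n → ℕ)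
  | 0 => pure Fin.elim0
  | n + 1 => (Filter.hyperfilter ℕ).bind (fun i => (iterU n).map (Fin.cons i))

theorem iterU_succ (n : ℕ) (R : (Fin (n + 1) → ℕ) → Prop) :
    (∀ᶠ f in (iterU (n + 1) : Filter (Fin (n + 1) → ℕ)), R f) ↔
      ∀ᶠ i in ((Filter.hyperfilter ℕ : Ultrafilter ℕ) : Filter ℕ),
        ∀ᶠ f in (iterU n : Filter (Fin n → ℕ)), R (Fin.cons i f) := Iff.rfl

theorem iterU_sub (n : ℕ) : ∀ (m : ℕ) (σ : Fin m → Fin n), StrictMono σ →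
    ∀ R : (Fin m → ℕ) → Prop, (∀ᶠ f in (iterU n : Filter (Fin n → ℕ)), R (f ∘ σ)) ↔
      ∀ᶠ f in (iterU m : Filter (Fin m → ℕ)), R f := by
  induction n with
  | zero =>
    intro m σ hσ R
    cases m with
    | zero =>
      have : ∀ f : Fin 0 → ℕ, f ∘ σ = f := fun f => Subsingleton.elim _ _
      simp [this]
    | succ m => exact (σ 0).elim0
  | succ n ih =>
    intro m σ hσ R
    rw [iterU_succ]
    by_cases h : ∃ m', m = m' + 1 ∧ ∀ i : Fin m, (i : ℕ) = 0 → σ i = 0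
    · obtain ⟨m, rfl, h⟩ := h
      have h0 : σ 0 = 0 := h 0 rfl
      have hpos : ∀ i : Fin m, σ i.succ ≠ 0 := by
        intro i hi
        have := hσ (Fin.succ_pos i)
        rw [h0, hi] at this
        exact lt_irrefl _ this
      rw [iterU_succ]
      refine Filter.eventually_congr (Filter.Eventually.of_forall fun i => ?_)
      let σ' : Fin m → Fin n := fun j => (σ j.succ).pred (hpos j)
      have hσ' : StrictMono σ' := by
        intro a b hab
        exact Fin.pred_lt_pred_iff.2 (hσ (Fin.succ_lt_succ_iff.2 hab))
      rw [← ih m σ' hσ' (fun f => R (Fin.cons i f))]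
      refine Filter.eventually_congr (Filter.Eventually.of_forall fun f => ?_)
      apply iff_of_eq; congr 1
      funext j
      refine Fin.cases ?_ (fun j => ?_) j
      · simp [h0]
      · have : σ j.succ = (σ' j).succ := by simp [σ']
        simp [this]
    · have hpos : ∀ i : Fin m, σ i ≠ 0 := by
        intro i hi
        apply h
        obtain ⟨m', rfl⟩ : ∃ m', m = m' + 1 := ⟨m - 1, by have := i.2; omega⟩
        refine ⟨m', rfl, fun j hj => ?_⟩
        have : j ≤ i := by
          rw [Fin.le_def]; omega
        have := hσ.monotone this
        rw [hi] at this
        exact Fin.le_zero_iff.1 this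
      let σ' : Fin m → Fin n := fun j => (σ j).pred (hpos j)
      have hσ' : StrictMono σ' := by
        intro a b hab
        exact Fin.pred_lt_pred_iff.2 (hσ hab)
      have : ∀ (i : ℕ) (f : Fin n → ℕ), (Fin.cons i f : Fin (n + 1) → ℕ) ∘ σ = f ∘ σ' := by
        intro i f
        funext j
        have : σ j = (σ' j).succ := by simp [σ']
        simp [this]
      simp only [this, ih m σ' hσ']
      simp

theorem exists_index_ultra : ∃ Q : Ultrafilter (ℤ → ℕ),
    (∀ (m : ℕ) (σ τ : Fin m → ℤ), StrictMono σ → StrictMono τ → ∀ R : (Fin m → ℕ) → Prop,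
      (∀ᶠ ι in (Q : Filter (ℤ → ℕ)), R (ι ∘ σ)) → ∀ᶠ ι in (Q : Filter (ℤ → ℕ)), R (ι ∘ τ)) ∧
    ∀ i j : ℤ, i < j → ∀ᶠ ι in (Q : Filter (ℤ → ℕ)), ι i < ι j := by
  let ext : ∀ n : ℕ, (Fin (2 * n + 1) → ℕ) → ℤ → ℕ := fun n f i =>
    if h : (i + n).toNat < 2 * n + 1 then f ⟨(i + n).toNat, h⟩ else 0
  let Q : Ultrafilter (ℤ → ℕ) :=
    (Filter.hyperfilter ℕ).bind (fun n => (iterU (2 * n + 1)).map (ext n))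
  have hQ : ∀ P : (ℤ → ℕ) → Prop, (∀ᶠ ι in (Q : Filter (ℤ → ℕ)), P ι) ↔
      ∀ᶠ n in ((Filter.hyperfilter ℕ : Ultrafilter ℕ) : Filter ℕ),
        ∀ᶠ f in (iterU (2 * n + 1) : Filter (Fin (2 * n + 1) → ℕ)), P (ext n f) :=
    fun P => Iff.rfl
  have key : ∀ (m : ℕ) (σ : Fin m → ℤ), StrictMono σ → ∀ R : (Fin m → ℕ) → Prop,
      (∀ᶠ ι in (Q : Filter (ℤ → ℕ)), R (ι ∘ σ)) ↔
        ∀ᶠ f in (iterU m : Filter (Fin m → ℕ)), R f := by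
    intro m σ hσ R
    rw [hQ]
    have h1 : ∀ᶠ n in ((Filter.hyperfilter ℕ : Ultrafilter ℕ) : Filter ℕ),
        ∀ i, (σ i).natAbs < n := by
      rw [Filter.eventually_all]
      intro i
      exact Nat.hyperfilter_le_atTop (Filter.eventually_gt_atTop _)
    have h2 : ∀ᶠ n in ((Filter.hyperfilter ℕ : Ultrafilter ℕ) : Filter ℕ),
        ((∀ᶠ f in (iterU (2 * n + 1) : Filter (Fin (2 * n + 1) → ℕ)), R (ext n f ∘ σ)) ↔
          ∀ᶠ f in (iterU m : Filter (Fin m → ℕ)), R f) := by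
      filter_upwards [h1] with n hn
      let σ' : Fin m → Fin (2 * n + 1) := fun i => ⟨(σ i + n).toNat, by have := hn i; omega⟩
      have hσ' : StrictMono σ' := by
        intro a b hab
        have h3 := hσ hab
        have h4 := hn a
        have h5 := hn b
        simp only [σ', Fin.lt_def]
        omega
      rw [← iterU_sub _ m σ' hσ']
      refine Filter.eventually_congr (Filter.Eventually.of_forall fun f => ?_)
      apply iff_of_eq; congr 1
      funext i
      have h6 : (σ i + n).toNat < 2 * n + 1 := by have := hn i; omega
      exact dif_pos h6
    rw [Filter.eventually_congr h2]
    simp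
  refine ⟨Q, ?_, ?_⟩
  · intro m σ τ hσ hτ R h
    rw [key m τ hτ]
    rwa [key m σ hσ] at h
  · intro i j hij
    have hσ : StrictMono (![i, j] : Fin 2 → ℤ) := by
      rw [Fin.strictMono_iff_lt_succ]
      intro a
      have : a = 0 := Subsingleton.elim _ _
      subst this
      simpa using hij
    have h := (key 2 ![i, j] hσ (fun f => f 0 < f 1)).2 (by
      rw [iterU_succ]
      refine Filter.Eventually.of_forall fun a => ?_
      rw [iterU_succ]
      have : ∀ᶠ c in ((Filter.hyperfilter ℕ : Ultrafilter ℕ) : Filter ℕ), a < c :=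
        Nat.hyperfilter_le_atTop (Filter.eventually_gt_atTop _)
      filter_upwards [this] with c hc
      refine Filter.Eventually.of_forall fun f => ?_
      simpa using hc)
    filter_upwards [h] with ι hι
    simpa using hι

end Helpers4

section Helpers5

variable {L : FirstOrder.Language.{u, v}} {N : Type w} [L.Structure N]
variable {M : L.ElementarySubstructure N}

/-! ### Using distality -/

theorem ultra_iff {X : Type*} (Q : Ultrafilter X) {A B : X → Prop}
    (h1 : (∀ᶠ x in (Q : Filter X), A x) → ∀ᶠ x in (Q : Filter X), B x)
    (h2 : (∀ᶠ x in (Q : Filter X), B x) → ∀ᶠ x in (Q : Filter X), A x) :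
    ∀ᶠ x in (Q : Filter X), (A x ↔ B x) := by
  by_cases hA : ∀ᶠ x in (Q : Filter X), A x
  · filter_upwards [hA, h1 hA] with x ha hb
    exact ⟨fun _ => hb, fun _ => ha⟩
  · have hB : ¬ ∀ᶠ x in (Q : Filter X), B x := fun h => hA (h2 h)
    rw [← Ultrafilter.eventually_not] at hA hB
    filter_upwards [hA, hB] with x ha hb
    exact ⟨fun h => absurd h ha, fun h => absurd h hb⟩

theorem dist_partA [Nonempty N] (hd : IsDistal L N) {ny : ℕ} {ξ : Type}
    {φ : (ξ ⊕ Fin ny → N) → Prop} (hφ : MDef M φ) (b : ℕ → Fin ny → N)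
    (Θ : Ultrafilter (ξ → N)) (hΘ : ∀ i, ∀ᶠ a in (Θ : Filter (ξ → N)), φ (Sum.elim a (b i)))
    (Q : Ultrafilter (ℤ → ℕ))
    (hQ : ∀ (m : ℕ) (σ τ : Fin m → ℤ), StrictMono σ → StrictMono τ → ∀ R : (Fin m → ℕ) → Prop,
      (∀ᶠ ι in (Q : Filter (ℤ → ℕ)), R (ι ∘ σ)) → ∀ᶠ ι in (Q : Filter (ℤ → ℕ)), R (ι ∘ τ)) :
    ∃ (T₁ : (ℤ × Fin ny → N) → Prop) (T₂ : (ξ ⊕ ({i : ℤ // i ≠ 0} × Fin ny) → N) → Prop),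
      MDef M T₁ ∧ MDef M T₂ ∧
      (∀ᶠ ι in (Q : Filter (ℤ → ℕ)), T₁ (fun q : ℤ × Fin ny => b (ι q.1) q.2)) ∧
      (∀ᶠ ι in (Q : Filter (ℤ → ℕ)), ∀ᶠ a in (Θ : Filter (ξ → N)),
        T₂ (Sum.elim a (fun q : {i : ℤ // i ≠ 0} × Fin ny => b (ι q.1) q.2))) ∧
      ∀ (x : ξ → N) (y : ℤ × Fin ny → N), T₁ y → T₂ (Sum.elim x (fun q => y (q.1, q.2))) →
        φ (Sum.elim x (fun j => y (0, j))) := by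
  classical
  let GS : Set (ξ ⊕ (ℤ × Fin ny) → N) → Prop := fun S => ∃ (T₁ : (ℤ × Fin ny → N) → Prop)
        (T₂ : (ξ ⊕ ({i : ℤ // i ≠ 0} × Fin ny) → N) → Prop),
        MDef M T₁ ∧ MDef M T₂ ∧
        (∀ᶠ ι in (Q : Filter (ℤ → ℕ)), T₁ (fun q : ℤ × Fin ny => b (ι q.1) q.2)) ∧
        (∀ᶠ ι in (Q : Filter (ℤ → ℕ)), ∀ᶠ a in (Θ : Filter (ξ → N)),
          T₂ (Sum.elim a (fun q : {i : ℤ // i ≠ 0} × Fin ny => b (ι q.1) q.2))) ∧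
        ∀ w : ξ ⊕ (ℤ × Fin ny) → N, T₁ (fun q => w (Sum.inr q)) →
          T₂ (Sum.elim (fun i => w (Sum.inl i)) (fun q => w (Sum.inr (q.1, q.2)))) →
          ¬ φ (Sum.elim (fun i => w (Sum.inl i)) (fun j => w (Sum.inr (0, j)))) → w ∈ S
  let G : Filter (ξ ⊕ (ℤ × Fin ny) → N) :=
    { sets := GS
      univ_sets := ⟨fun _ => True, fun _ => True, MDef.true, MDef.true, by simp, by simp,
        fun _ _ _ _ => trivial⟩
      sets_of_superset := fun ⟨T₁, T₂, h1, h2, h3, h4, h5⟩ hxy =>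
        ⟨T₁, T₂, h1, h2, h3, h4, fun w a c d => hxy (h5 w a c d)⟩
      inter_sets := fun ⟨T₁, T₂, h1, h2, h3, h4, h5⟩ ⟨T₁', T₂', h1', h2', h3', h4', h5'⟩ =>
        ⟨_, _, h1.and h1', h2.and h2', h3.and h3',
          (h4.and h4').mono fun ι hι => hι.1.and hι.2,
          fun w a c d => ⟨h5 w a.1 c.1 d, h5' w a.2 c.2 d⟩⟩ }
  have hG : ∀ S, S ∈ G ↔ ∃ (T₁ : (ℤ × Fin ny → N) → Prop)
        (T₂ : (ξ ⊕ ({i : ℤ // i ≠ 0} × Fin ny) → N) → Prop),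
        MDef M T₁ ∧ MDef M T₂ ∧
        (∀ᶠ ι in (Q : Filter (ℤ → ℕ)), T₁ (fun q : ℤ × Fin ny => b (ι q.1) q.2)) ∧
        (∀ᶠ ι in (Q : Filter (ℤ → ℕ)), ∀ᶠ a in (Θ : Filter (ξ → N)),
          T₂ (Sum.elim a (fun q : {i : ℤ // i ≠ 0} × Fin ny => b (ι q.1) q.2))) ∧
        ∀ w : ξ ⊕ (ℤ × Fin ny) → N, T₁ (fun q => w (Sum.inr q)) →
          T₂ (Sum.elim (fun i => w (Sum.inl i)) (fun q => w (Sum.inr (q.1, q.2)))) →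
          ¬ φ (Sum.elim (fun i => w (Sum.inl i)) (fun j => w (Sum.inr (0, j)))) → w ∈ S :=
    fun S => Iff.rfl
  by_cases hne : ∅ ∈ G
  · obtain ⟨T₁, T₂, h1, h2, h3, h4, h5⟩ := (hG ∅).1 hne
    refine ⟨T₁, T₂, h1, h2, h3, h4, fun x y hy1 hy2 => ?_⟩
    by_contra hcon
    exact h5 (Sum.elim x y) hy1 hy2 hcon
  exfalso
  have : G.NeBot := ⟨fun h => hne (by rw [h]; trivial)⟩
  let V := Ultrafilter.of G
  have hV : (V : Filter (ξ ⊕ (ℤ × Fin ny) → N)) ≤ G := Ultrafilter.of_le G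
  obtain ⟨E, cls, hemb, hlos⟩ := exists_ultraExt (L := L) (N := N) V
  let a' : ξ → E.Carrier := fun i => cls (fun w => w (Sum.inl i))
  let b' : ℤ → Fin ny → E.Carrier := fun i j => cls (fun w => w (Sum.inr (i, j)))
  let A : Set E.Carrier := Set.range (fun m : M => E.emb (m : N)) ∪ Set.range a'
  -- evaluation of parameters
  have hI0 : IsIndiscernibleOver L (∅ : Set E.Carrier) b' := by
    intro m σ τ hσ hτ p χ c hc
    have hp : IsEmpty (Fin p) := ⟨fun i => hc i⟩
    have hx : ∀ ρ : Fin m → ℤ, (χ.Realize (Sum.elim (fun q : Fin m × Fin ny => b' (ρ q.1) q.2) c) ↔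
        ∀ᶠ w in (V : Filter (ξ ⊕ (ℤ × Fin ny) → N)), χ.Realize
          (Sum.elim (fun q : Fin m × Fin ny => w (Sum.inr (ρ q.1, q.2))) (fun i => hp.elim i))) := by
      intro ρ
      refine Iff.trans ?_ ((hlos _ χ (Sum.elim
        (fun (q : Fin m × Fin ny) w => w (Sum.inr (ρ q.1, q.2))) (fun i => hp.elim i))).trans ?_)
      · apply iff_of_eq; congr 1
        funext i
        rcases i with i | i
        · rfl
        · exact hp.elim i
      · refine Filter.eventually_congr (Filter.Eventually.of_forall fun w => ?_)
        apply iff_of_eq; congr 1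
        funext i
        rcases i with i | i
        · rfl
        · exact hp.elim i
    rw [hx σ, hx τ]
    apply Filter.eventually_congr
    apply hV
    have d : MDef M (fun y : Fin m × Fin ny → N => χ.Realize (Sum.elim y (fun i => hp.elim i))) :=
      mdef_of_formula χ _ (fun i => hp.elim i)
    refine ⟨_, fun _ => True, ((d.pre (fun (y : ℤ × Fin ny → N) q => y (σ q.1, q.2))
      (fun q => (σ q.1, q.2)) (fun _ _ => rfl)).iff
      (d.pre (fun (y : ℤ × Fin ny → N) q => y (τ q.1, q.2))
      (fun q => (τ q.1, q.2)) (fun _ _ => rfl))), MDef.true, ?_, by simp,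
      fun w h _ _ => h⟩
    apply ultra_iff
    · exact hQ m σ τ hσ hτ (fun f => χ.Realize (Sum.elim (fun q : Fin m × Fin ny => b (f q.1) q.2)
        (fun i => hp.elim i)))
    · exact hQ m τ σ hτ hσ (fun f => χ.Realize (Sum.elim (fun q : Fin m × Fin ny => b (f q.1) q.2)
        (fun i => hp.elim i)))
  have hpar : ∀ (p : ℕ) (c : Fin p → E.Carrier), (∀ i, c i ∈ A) → ∃ κ : Fin p → ξ ⊕ M,
      ∀ i, c i = cls (fun w => Sum.elim (fun i => w (Sum.inl i)) ((↑) : M → N) (κ i)) := by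
    intro p c hc
    have : ∀ i, ∃ k : ξ ⊕ M,
      c i = cls (fun w => Sum.elim (fun i => w (Sum.inl i)) ((↑) : M → N) k) := by
      intro i
      rcases hc i with ⟨m, hm⟩ | ⟨j, hj⟩
      · refine ⟨Sum.inr m, ?_⟩
        rw [← hm]
        exact (hemb m).symm
      · exact ⟨Sum.inl j, hj.symm⟩
    choose κ hκ using this
    exact ⟨κ, hκ⟩
  have hx : ∀ (m p : ℕ) (χ : L.Formula ((Fin m × Fin ny) ⊕ Fin p)) (c : Fin p → E.Carrier)
      (κ : Fin p → ξ ⊕ M)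
      (_ : ∀ i, c i = cls (fun w => Sum.elim (fun i => w (Sum.inl i)) ((↑) : M → N) (κ i)))
      (ρ : Fin m → ℤ), (χ.Realize (Sum.elim (fun q : Fin m × Fin ny => b' (ρ q.1) q.2) c) ↔
        ∀ᶠ w in (V : Filter (ξ ⊕ (ℤ × Fin ny) → N)), χ.Realize
          (Sum.elim (fun q : Fin m × Fin ny => w (Sum.inr (ρ q.1, q.2)))
            (fun i => Sum.elim (fun i => w (Sum.inl i)) ((↑) : M → N) (κ i)))) := by
    intro m p χ c κ hκ ρ
    refine Iff.trans ?_ ((hlos _ χ (Sum.elim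
        (fun (q : Fin m × Fin ny) w => w (Sum.inr (ρ q.1, q.2)))
        (fun i w => Sum.elim (fun i => w (Sum.inl i)) ((↑) : M → N) (κ i)))).trans ?_)
    · apply iff_of_eq; congr 1
      funext i
      rcases i with i | i
      · rfl
      · exact hκ i
    · refine Filter.eventually_congr (Filter.Eventually.of_forall fun w => ?_)
      apply iff_of_eq; congr 1
      funext i
      rcases i with i | i <;> rfl
  have hI1 : IsIndiscernibleOver L A (fun i : {i : ℤ // i ≠ 0} => b' i) := by
    intro m σ τ hσ hτ p χ c hc
    obtain ⟨κ, hκ⟩ := hpar p c hc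
    refine (hx m p χ c κ hκ (fun i => σ i)).trans
      (Iff.trans ?_ (hx m p χ c κ hκ (fun i => τ i)).symm)
    apply Filter.eventually_congr
    apply hV
    have d : ∀ ρ : Fin m → {i : ℤ // i ≠ 0}, MDef M
        (fun y : ξ ⊕ ({i : ℤ // i ≠ 0} × Fin ny) → N => χ.Realize (Sum.elim
          (fun q : Fin m × Fin ny => y (Sum.inr (ρ q.1, q.2)))
          (fun i => Sum.elim (fun i => y (Sum.inl i)) ((↑) : M → N) (κ i)))) := by
      intro ρ
      refine ⟨χ.relabel (Sum.elim (fun q => Sum.inl (Sum.inr (ρ q.1, q.2)))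
        (fun i => Sum.elim (fun i => Sum.inl (Sum.inl i)) Sum.inr (κ i))), fun y => ?_⟩
      rw [Formula.realize_relabel]
      apply iff_of_eq; congr 1
      funext i
      rcases i with i | i
      · rfl
      · simp only [Function.comp, Sum.elim_inr]
        rcases κ i with k | k <;> rfl
    refine ⟨fun _ => True, _, MDef.true, (d σ).iff (d τ), by simp, ?_, fun w _ h _ => h⟩
    have e1 := hQ m (fun i => σ i) (fun i => τ i) hσ hτ (fun f => ∀ᶠ a in (Θ : Filter (ξ → N)),
      χ.Realize (Sum.elim (fun q : Fin m × Fin ny => b (f q.1) q.2)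
        (fun i => Sum.elim a ((↑) : M → N) (κ i))))
    have e2 := hQ m (fun i => τ i) (fun i => σ i) hτ hσ (fun f => ∀ᶠ a in (Θ : Filter (ξ → N)),
      χ.Realize (Sum.elim (fun q : Fin m × Fin ny => b (f q.1) q.2)
        (fun i => Sum.elim a ((↑) : M → N) (κ i))))
    filter_upwards [ultra_iff Q e1 e2] with ι hι
    exact ultra_iff Θ hι.1 hι.2
  have hI2 := hd.2 E ny b' A hI0 hI1
  -- contradiction
  obtain ⟨ψ, hψ⟩ := hφ
  obtain ⟨p, ψ', κ, hψ'⟩ := formula_support (ψ.relabel (Sum.elim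
    (Sum.elim (fun i => Sum.inr (Sum.inl i)) (fun j => Sum.inl ((0 : Fin 1), j)))
    (fun m => Sum.inr (Sum.inr m)) : (ξ ⊕ Fin ny) ⊕ M → (Fin 1 × Fin ny) ⊕ (ξ ⊕ M)))
  have hval : ∀ (y : Fin 1 × Fin ny → N) (x : ξ → N),
      ψ'.Realize (Sum.elim y (fun i => Sum.elim x ((↑) : M → N) (κ i))) ↔
        φ (Sum.elim x (fun j => y (0, j))) := by
    intro y x
    refine (hψ' N y (Sum.elim x ((↑) : M → N))).trans ?_
    rw [Formula.realize_relabel, ← hψ]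
    apply iff_of_eq; congr 1
    funext i
    rcases i with (i | i) | i <;> rfl
  let c : Fin p → E.Carrier :=
    fun i => cls (fun w => Sum.elim (fun i => w (Sum.inl i)) ((↑) : M → N) (κ i))
  have hcA : ∀ i, c i ∈ A := by
    intro i
    rcases h : κ i with k | k
    · refine Or.inr ⟨k, ?_⟩
      simp [c, h, a']
    · refine Or.inl ⟨k, ?_⟩
      simp [c, h, ← hemb]
  have hmono : ∀ ρ : Fin 1 → ℤ, StrictMono ρ := fun ρ a b hab =>
    absurd hab (by rw [Subsingleton.elim a b]; exact lt_irrefl _)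
  have hfin := hI2 1 (fun _ => 0) (fun _ => 1) (hmono _) (hmono _) p ψ' c hcA
  rw [hx 1 p ψ' c κ (fun _ => rfl) (fun _ => 0), hx 1 p ψ' c κ (fun _ => rfl) (fun _ => 1)] at hfin
  simp only [hval] at hfin
  have hdφ : MDef M φ := ⟨ψ, hψ⟩
  have f1 : ∀ᶠ w in (V : Filter (ξ ⊕ (ℤ × Fin ny) → N)),
      φ (Sum.elim (fun i => w (Sum.inl i)) (fun j => w (Sum.inr (1, j)))) := by
    apply hV
    refine ⟨fun _ => True, fun x => φ (Sum.elim (fun i => x (Sum.inl i))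
      (fun j => x (Sum.inr (⟨1, one_ne_zero⟩, j)))), MDef.true, hdφ.lmap _, by simp, ?_,
      fun w _ h _ => h⟩
    exact Filter.Eventually.of_forall fun ι => hΘ (ι 1)
  have f0 : ∀ᶠ w in (V : Filter (ξ ⊕ (ℤ × Fin ny) → N)),
      ¬ φ (Sum.elim (fun i => w (Sum.inl i)) (fun j => w (Sum.inr (0, j)))) := by
    apply hV
    exact ⟨fun _ => True, fun _ => True, MDef.true, MDef.true, by simp, by simp,
      fun w _ _ h => h⟩
  obtain ⟨w, hw⟩ := ((hfin.2 f1).and f0).exists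
  exact hw.2 hw.1

end Helpers5

section Helpers6

variable {L : FirstOrder.Language.{u, v}} {N : Type w} [L.Structure N]
variable {M : L.ElementarySubstructure N}

/-! ### The uniform honest definition -/

variable (M) in
/-- the strictness property of the coheir `U` with respect to `b` -/
def StrictFor {β : Type} (U : Ultrafilter (β → N)) (b : β → N) : Prop :=
  ∀ (ζ : Type) [Finite ζ] (e : ζ → N) (χ : (ζ ⊕ β → N) → Prop), MDef M χ →
    (∀ᶠ m in (U : Filter (β → N)), χ (Sum.elim e m)) →
    ∃ p : Ultrafilter (ζ → N), FInv M (p : Filter (ζ → N)) ∧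
      ∀ᶠ a in (p : Filter (ζ → N)), χ (Sum.elim a b)

theorem strict_left (H : SatP M) {β : Type} [Finite β] {U : Ultrafilter (β → N)} {b : β → N}
    (hst : StrictFor M U b) {ζ : Type} [Finite ζ] (e : ζ → N) (h : β → N) (hr : Rlz M U e h)
    {ι : Type} [Finite ι] (B : ι → β → N) (hB : ∀ i, TEq M (B i) b) :
    ∃ e' : ζ → N, ∀ i, TEq M (Sum.elim e h) (Sum.elim e' (B i)) := by
  obtain ⟨a, ha⟩ := H ζ (ι × β) (fun q => B q.1 q.2)
    (fun P => MDef M P ∧ ∃ t : (ζ ⊕ β → N) → Prop, MDef M t ∧ t (Sum.elim e h) ∧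
      ∀ x : ζ ⊕ (ι × β) → N, (∀ i, t (Sum.elim (fun j => x (Sum.inl j))
        (fun j => x (Sum.inr (i, j))))) → P x)
    (fun s hs => hs.1)
    (fun s t ⟨h1, t1, h2, h3, h4⟩ ⟨h1', t1', h2', h3', h4'⟩ =>
      ⟨h1.and h1', _, h2.and h2', ⟨h3, h3'⟩, fun x hx =>
        ⟨h4 x fun i => (hx i).1, h4' x fun i => (hx i).2⟩⟩)
    (by
      rintro s ⟨h1, t, h2, h3, h4⟩
      have h2' : MDef M (fun x : β ⊕ ζ → N => t (fun i => x i.swap)) :=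
        h2.pre _ Sum.swap (fun _ _ => rfl)
      have hsw : ∀ (x : β → N) (y : ζ → N),
          (fun i : ζ ⊕ β => (Sum.elim x y : β ⊕ ζ → N) i.swap) = Sum.elim y x := by
        intro x y; funext i; cases i <;> rfl
      have h5 := (hr.iff h2').2 (by rw [hsw]; exact h3)
      simp only [hsw] at h5
      obtain ⟨p, hp, hp2⟩ := hst ζ e t h2 h5
      have h6 : ∀ i, ∀ᶠ a in (p : Filter (ζ → N)), t (Sum.elim a (B i)) := fun i =>
        hp β t h2 b (B i) (hB i).symm hp2
      obtain ⟨a, ha⟩ := (Filter.eventually_all.2 h6).exists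
      exact ⟨a, h4 _ fun i => ha i⟩)
  refine ⟨a, fun i P hP hp => ?_⟩
  exact ha (fun x => P (Sum.elim (fun j => x (Sum.inl j)) (fun j => x (Sum.inr (i, j)))))
    ⟨hP.pre _ (Sum.map id (fun j => (i, j))) (fun x i => by cases i <;> rfl), P, hP, hp,
      fun x hx => hx i⟩

theorem exists_array (H : SatP M) {β : Type} [Finite β] {U : Ultrafilter (β → N)} {b : β → N}
    (hU : OnM M U) (hst : StrictFor M U b) (k : ℕ) (s : ℕ → β → N)
    (hs : Morley M U (Empty.elim : Empty → N) (2 * k + 1) s)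
    {ι : Type} [Finite ι] (B : ι → β → N) (hB : ∀ i, TEq M (B i) b) :
    ∃ c : Fin (2 * k) × β → N, ∀ i, TEq M
      (Sum.elim (fun q : Fin (2 * k) × β => s (if (q.1 : ℕ) < k then q.1 else q.1 + 1) q.2) (s k))
      (Sum.elim c (B i)) := by
  have hr : Rlz M U (pfx k s) (s k) :=
    (hs k (by omega)).restrict Sum.inl (fun _ => rfl)
  obtain ⟨e, he⟩ := strict_left H hst (pfx k s) (s k) hr B hB
  obtain ⟨f, hf⟩ := H.exists_morley U (Sum.elim e (fun q : ι × β => B q.1 q.2))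
  have hs2 : Morley M U (Sum.elim (pfx k s) (s k)) k (fun i => s (k + 1 + i)) :=
    hs.sub (fun i => k + 1 + i)
      (Sum.elim (fun q => Sum.inl ((q.1 : ℕ), q.2)) (fun j => Sum.inl (k, j))) (k + 1)
      (by intros; omega) (by intros; omega) (by intros; omega)
      (by
        rintro (⟨i, j⟩ | j) q h
        · obtain rfl := Sum.inl.inj h
          have := i.2
          dsimp only; omega
        · obtain rfl := Sum.inl.inj h
          dsimp only; omega)
      (by rintro (⟨i, j⟩ | j) <;> rfl) (fun _ _ => rfl)
  refine ⟨fun q => if h : (q.1 : ℕ) < k then e (⟨q.1, h⟩, q.2) else f (q.1 - k) q.2, fun i => ?_⟩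
  have hf2 : Morley M U (Sum.elim e (B i)) k f :=
    (hf k).sub id (Sum.elim (fun q => Sum.inr (Sum.inl q)) (fun j => Sum.inr (Sum.inr (i, j)))) 0
      (fun i j h _ => h) (fun i h => h) (fun _ _ => Nat.zero_le _)
      (by rintro (j | j) q h <;> simp at h)
      (by rintro (j | j) <;> rfl) (fun _ _ => rfl)
  have key := hs2.tEq hU hf2 (he i)
  refine key.pre (Sum.elim (fun q => if h : (q.1 : ℕ) < k then Sum.inr (Sum.inl (⟨q.1, h⟩, q.2))
    else Sum.inl (⟨q.1 - k, by have := q.1.2; omega⟩, q.2)) (fun j => Sum.inr (Sum.inr j))) ?_ ?_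
  · rintro (⟨q, j⟩ | j)
    · by_cases h : (q : ℕ) < k
      · simp [h, pfx]
      · have e1 : k + 1 + ((q : ℕ) - k) = q + 1 := by omega
        simp [h, pfx, e1]
    · rfl
  · rintro (⟨q, j⟩ | j)
    · by_cases h : (q : ℕ) < k
      · simp [h]
      · simp [h, pfx]
    · rfl

theorem dist_partB [Nonempty N] (hd : IsDistal L N) (H : SatP M) {ny : ℕ} {ξ : Type}
    {φ : (ξ ⊕ Fin ny → N) → Prop} (hφ : MDef M φ) {U : Ultrafilter (Fin ny → N)}
    {b : Fin ny → N} (hU : OnM M U) (hst : StrictFor M U b) (b' : ℕ → Fin ny → N)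
    (hb' : ∀ n, Morley M U (Empty.elim : Empty → N) n b')
    (Θ : Ultrafilter (ξ → N))
    (hΘ : ∀ i, ∀ᶠ a in (Θ : Filter (ξ → N)), φ (Sum.elim a (b' i))) :
    ∃ (k : ℕ) (θ : (ξ ⊕ (Fin k × Fin ny) → N) → Prop) (c0 : Fin k × Fin ny → N), MDef M θ ∧
      (∀ᶠ a in (Θ : Filter (ξ → N)), θ (Sum.elim a c0)) ∧
      ∀ (ι : Type) [Finite ι] (B : ι → Fin ny → N), (∀ i, TEq M (B i) b) →
        ∃ c, TEq M c c0 ∧ ∀ i a, θ (Sum.elim a c) → φ (Sum.elim a (B i)) := by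
  classical
  obtain ⟨Q, hQ, hQlt⟩ := exists_index_ultra
  obtain ⟨T₁, T₂, hT1, hT2, h1, h2, h3⟩ := dist_partA hd hφ b' Θ hΘ Q hQ
  obtain ⟨F1, hF1⟩ := hT1.support
  obtain ⟨F2, hF2⟩ := hT2.support
  let g2 : ξ ⊕ ({i : ℤ // i ≠ 0} × Fin ny) → ℕ := Sum.elim (fun _ => 0) (fun q => (q.1 : ℤ).natAbs)
  obtain ⟨k, hk0, hk1, hk2⟩ : ∃ k : ℕ, 0 < k ∧ (∀ q ∈ F1, q.1.natAbs ≤ k) ∧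
      (∀ q ∈ F2, g2 q ≤ k) := by
    refine ⟨F1.sup (fun q => q.1.natAbs) + F2.sup g2 + 1, by omega, fun q hq => ?_, fun q hq => ?_⟩
    · have := Finset.le_sup (f := fun q : ℤ × Fin ny => q.1.natAbs) hq
      omega
    · have := Finset.le_sup (f := g2) hq
      omega
  have h4 : ∀ᶠ ι in (Q : Filter (ℤ → ℕ)), ∀ p : Fin (2 * k + 1) × Fin (2 * k + 1), p.1 < p.2 →
      ι ((p.1 : ℕ) - (k : ℤ)) < ι ((p.2 : ℕ) - (k : ℤ)) := by
    refine Filter.eventually_all.2 fun p => ?_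
    by_cases hp : p.1 < p.2
    · have : ((p.1 : ℕ) - (k : ℤ)) < ((p.2 : ℕ) - (k : ℤ)) := by
        have : (p.1 : ℕ) < p.2 := hp
        omega
      filter_upwards [hQlt _ _ this] with ι hι _ using hι
    · exact Filter.Eventually.of_forall fun _ h => absurd h hp
  obtain ⟨ι, hi1, hi2, hi4⟩ := (h1.and (h2.and h4)).exists
  let s : ℕ → Fin ny → N := fun n => b' (ι ((n : ℤ) - k))
  have hlt : ∀ i j : ℕ, i < j → j < 2 * k + 1 → ι ((i : ℤ) - k) < ι ((j : ℤ) - k) := by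
    intro i j hij hj
    exact hi4 (⟨i, by omega⟩, ⟨j, hj⟩) hij
  have hs : Morley M U (Empty.elim : Empty → N) (2 * k + 1) s := by
    refine (hb' (ι (((2 * k : ℕ) : ℤ) - k) + 1)).sub (fun n => ι ((n : ℤ) - k)) (fun i => i.elim) 0
      hlt ?_ (fun _ _ => Nat.zero_le _) (fun i => i.elim) (fun i => i.elim) (fun _ _ => rfl)
    intro i hi
    rcases Nat.lt_or_ge i (2 * k) with h | h
    · have := hlt i (2 * k) h (by omega)
      omega
    · obtain rfl : i = 2 * k := by omega
      omega
  let pos : ℤ → Fin (2 * k) := fun i =>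
    ⟨min (if i < 0 then (i + k).toNat else (i + k - 1).toNat) (2 * k - 1), by omega⟩
  let c0 : Fin (2 * k) × Fin ny → N := fun q => s (if (q.1 : ℕ) < k then q.1 else q.1 + 1) q.2
  have hpos : ∀ i : ℤ, i ≠ 0 → i.natAbs ≤ k → ∀ j, c0 (pos i, j) = b' (ι i) j := by
    intro i hi hik j
    have : (((if ((pos i : Fin (2 * k)) : ℕ) < k then (pos i : ℕ) else (pos i : ℕ) + 1 : ℕ) : ℤ) - k)
        = i := by
      simp only [pos]
      split_ifs <;> omega
    simp only [c0, s, this]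
  have hs0 : s k = b' (ι 0) := by simp [s]
  let τ : ((Fin (2 * k) × Fin ny) ⊕ Fin ny → N) → Prop := fun x =>
    T₁ (fun q => if q.1 = 0 then x (Sum.inr q.2) else x (Sum.inl (pos q.1, q.2)))
  have hτ : MDef M τ := hT1.pre _ (fun q => if q.1 = 0 then Sum.inr q.2 else Sum.inl (pos q.1, q.2))
    (fun x q => by split_ifs <;> rfl)
  have hτ0 : τ (Sum.elim c0 (s k)) := by
    refine (hF1 _ _ fun q hq => ?_).1 hi1
    by_cases h : q.1 = 0
    · simp [h, hs0]
    · simp [h, hpos q.1 h (hk1 q hq)]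
  refine ⟨2 * k, fun x => T₂ (Sum.elim (fun i => x (Sum.inl i))
    (fun q => x (Sum.inr (pos q.1, q.2)))), c0, ?_, ?_, ?_⟩
  · exact hT2.pre _ (Sum.map id (fun q => (pos q.1, q.2))) (fun x i => by cases i <;> rfl)
  · filter_upwards [hi2] with a ha
    refine (hF2 _ _ fun q hq => ?_).1 ha
    rcases q with q | q
    · rfl
    · exact (hpos q.1 q.1.2 (hk2 _ hq) _).symm
  · intro ι' _ B hB
    obtain ⟨c, hc⟩ := exists_array H hU hst k s hs (fun o : Option ι' => o.elim b B)
      (by rintro (_ | i); exact TEq.refl _; exact hB i)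
    refine ⟨c, ((hc none).pre Sum.inl (fun _ => rfl) (fun _ => rfl)).symm, fun i a ha => ?_⟩
    have h5 : τ (Sum.elim c (B i)) := hc (some i) τ hτ hτ0
    have h6 := h3 a _ h5
    refine h6 ?_
    have e : (fun q : {i : ℤ // i ≠ 0} × Fin ny => (if (q.1 : ℤ) = 0
        then (Sum.elim c (B i) : (Fin (2 * k) × Fin ny) ⊕ Fin ny → N) (Sum.inr q.2)
        else (Sum.elim c (B i) : (Fin (2 * k) × Fin ny) ⊕ Fin ny → N) (Sum.inl (pos q.1, q.2))))
        = fun q => c (pos q.1, q.2) := by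
      funext q
      rw [if_neg q.1.2]; rfl
    have e' : T₂ (Sum.elim a (fun q : {i : ℤ // i ≠ 0} × Fin ny => c (pos q.1, q.2))) := ha
    rw [← e] at e'
    exact e'

end Helpers6

section Helpers7

variable {L : FirstOrder.Language.{u, v}} {N : Type w} [L.Structure N]
variable {M : L.ElementarySubstructure N}

/-! ### Dividing -/

theorem same_formula {K : Type*} [L.Structure K] {A : Set K} {γ ι : Type*} {x y : γ → K}
    (h : SameTypeOver L A x y) (f : ι → K) (hf : ∀ i, f i ∈ A) (ψ : L.Formula (γ ⊕ ι)) :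
    ψ.Realize (Sum.elim x f) ↔ ψ.Realize (Sum.elim y f) := by
  obtain ⟨p, ψ', m, hm⟩ := formula_support ψ
  rw [← hm, ← hm]
  exact h p ψ' _ (fun i => hf _)

theorem elim_comp_emb {γ ι K K' : Type*} (e : K → K') (x : γ → K) (y : ι → K) :
    (Sum.elim (e ∘ x) (e ∘ y) : γ ⊕ ι → K') = e ∘ Sum.elim x y := by
  funext i; cases i <;> rfl

theorem SameTypeOver.emb {A : Set N} {γ : Type*} {x y : γ → N} (h : SameTypeOver L A x y)
    (E : ElemExt L N) : SameTypeOver L (⇑E.emb '' A) (⇑E.emb ∘ x) (⇑E.emb ∘ y) := by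
  intro p φ m hm
  choose m' hm' hmm using hm
  obtain rfl : m = ⇑E.emb ∘ m' := funext fun i => (hmm i).symm
  rw [elim_comp_emb, elim_comp_emb, E.emb.map_formula, E.emb.map_formula]
  exact h p φ m' hm'

theorem consistent_of_not_divides {A : Set N} {α γ : Type} {φ : L.Formula (α ⊕ γ)} {b : γ → N}
    (h : ¬ Divides L A φ b) (c : ℕ → γ → N) (hc : IsIndiscernibleOver L A c)
    (hc0 : SameTypeOver L A (c 0) b) : IsConsistentFamily L φ c := by
  let e : N ≃ ULift.{max u v} N := Equiv.ulift.symm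
  let _ : L.Structure (ULift.{max u v} N) := e.inducedStructure
  let E : ElemExt L N :=
    { Carrier := ULift.{max u v} N
      emb := (e.inducedStructureEquiv (L := L)).toElementaryEmbedding }
  have hE : ∀ x : ULift.{max u v} N, E.emb x.down = x := fun x => rfl
  have h1 : IsConsistentFamily L φ (fun n => ⇑E.emb ∘ c n) := by
    by_contra hcon
    refine h ⟨E, fun n => ⇑E.emb ∘ c n, ?_, hc0.emb E, hcon⟩
    intro m i j hi hj
    exact (hc m i j hi hj).emb E
  intro s
  obtain ⟨a, ha⟩ := h1 s
  refine ⟨fun i => (a i : ULift.{max u v} N).down, fun i hi => ?_⟩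
  have h2 := ha i hi
  have h3 : a = ⇑E.emb ∘ fun i => (a i : ULift.{max u v} N).down := funext fun i => (hE _).symm
  rw [h3, elim_comp_emb, E.emb.map_formula] at h2
  exact h2

theorem not_divides_of_ultra (H : SatP M) {α γ : Type} [Finite α] [Finite γ]
    (ψ : L.Formula (α ⊕ γ)) (c : γ → N) (p : Ultrafilter (α → N))
    (hp : ∀ c', TEq M c c' → ∀ᶠ a in (p : Filter (α → N)), ψ.Realize (Sum.elim a c')) :
    ¬ Divides L (M : Set N) ψ c := by
  classical
  rintro ⟨E, cs, hind, hsame, hcon⟩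
  unfold IsConsistentFamily at hcon
  push Not at hcon
  obtain ⟨s, hs⟩ := hcon
  let f : M → E.Carrier := fun m => E.emb (m : N)
  have hf : ∀ m, f m ∈ ⇑E.emb '' (M : Set N) := fun m => ⟨m, m.2, rfl⟩
  let cE : s × γ → E.Carrier := fun q => cs q.1 q.2
  obtain ⟨c', hc'⟩ := H (s × γ) Empty Empty.elim
    (fun P => ∃ χ : L.Formula ((s × γ) ⊕ M), χ.Realize (Sum.elim cE f) ∧
      ∀ x, P x ↔ χ.Realize (Sum.elim (fun i => x (Sum.inl i)) ((↑) : M → N)))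
    (by
      rintro P ⟨χ, h1, h2⟩
      have d1 : MDef M (fun x : s × γ → N => χ.Realize (Sum.elim x ((↑) : M → N))) :=
        ⟨χ, fun x => Iff.rfl⟩
      exact (d1.pre (fun (x : (s × γ) ⊕ Empty → N) i => x (Sum.inl i)) Sum.inl
        (fun _ _ => rfl)).congr fun x => (h2 x).symm)
    (by
      rintro P P' ⟨χ, h1, h2⟩ ⟨χ', h1', h2'⟩
      exact ⟨χ ⊓ χ', Formula.realize_inf.2 ⟨h1, h1'⟩, fun x => by
        rw [Formula.realize_inf]; exact and_congr (h2 x) (h2' x)⟩)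
    (by
      rintro P ⟨χ, h1, h2⟩
      let χ' : L.Formula M := Formula.iExs (s × γ) (χ.relabel Sum.swap)
      have h3 : χ'.Realize (⇑E.emb ∘ ((↑) : M → N)) := by
        rw [Formula.realize_iExs]
        refine ⟨cE, ?_⟩
        rw [Formula.realize_relabel]
        convert h1 using 1
        funext i; cases i <;> rfl
      rw [E.emb.map_formula, Formula.realize_iExs] at h3
      obtain ⟨x, hx⟩ := h3
      refine ⟨x, (h2 _).2 ?_⟩
      rw [Formula.realize_relabel] at hx
      convert hx using 1
      funext i; cases i <;> rfl)
  have key : ∀ χ : L.Formula ((s × γ) ⊕ M), χ.Realize (Sum.elim cE f) →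
      χ.Realize (Sum.elim c' ((↑) : M → N)) := fun χ hχ =>
    hc' (fun x => χ.Realize (Sum.elim (fun i => x (Sum.inl i)) ((↑) : M → N)))
      ⟨χ, hχ, fun x => Iff.rfl⟩
  have k1 : ∀ i : s, TEq M c (fun g => c' (i, g)) := by
    rintro i P ⟨χ, hχ⟩ hP
    rw [← hχ] at hP ⊢
    have h1 : χ.Realize (Sum.elim (cs 0) f) := by
      rw [same_formula hsame f hf]
      have : f = ⇑E.emb ∘ ((↑) : M → N) := rfl
      rw [this, elim_comp_emb, E.emb.map_formula]
      exact hP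
    have h2 := hind 1 (fun _ => 0) (fun _ => i) (Subsingleton.strictMono _)
      (Subsingleton.strictMono _)
    have h3 := same_formula h2 f hf
      (χ.relabel (Sum.map (fun g : γ => ((0 : Fin 1), g)) id))
    rw [Formula.realize_relabel, Formula.realize_relabel, Sum.elim_comp_map, Sum.elim_comp_map]
      at h3
    have h4 : χ.Realize (Sum.elim (cs i) f) := h3.1 h1
    have h5 := key (χ.relabel (Sum.map (fun g : γ => (i, g)) id))
    rw [Formula.realize_relabel, Formula.realize_relabel, Sum.elim_comp_map, Sum.elim_comp_map]
      at h5
    exact h5 h4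
  let ω : L.Formula ((s × γ) ⊕ M) := (Formula.iExs α (Formula.iInf (fun i : s =>
    ψ.relabel (Sum.elim Sum.inr (fun g => Sum.inl (Sum.inl (i, g))) :
      α ⊕ γ → ((s × γ) ⊕ M) ⊕ α)))).not
  have k2 := key ω (by
    rw [Formula.realize_not, Formula.realize_iExs]
    rintro ⟨a, ha⟩
    rw [Formula.realize_iInf] at ha
    obtain ⟨i, hi, h⟩ := hs a
    apply h
    have := ha ⟨i, hi⟩
    rw [Formula.realize_relabel] at this
    convert this using 1
    funext j; cases j <;> rfl)
  rw [Formula.realize_not, Formula.realize_iExs] at k2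
  apply k2
  obtain ⟨a, ha⟩ := (Filter.eventually_all.2 fun i : s => hp _ (k1 i)).exists
  refine ⟨a, ?_⟩
  rw [Formula.realize_iInf]
  intro i
  rw [Formula.realize_relabel]
  convert ha i using 1
  funext j; cases j <;> rfl

theorem infinite_of_not_mem {ny : ℕ} (b : Fin ny → N) (hbM : ¬ ∀ i, b i ∈ M) : Infinite M := by
  by_contra hfin
  rw [not_infinite_iff_finite] at hfin
  have hne : ∀ (i : Fin ny) (m : M), MDef M (fun x : Fin ny → N => ¬ x i = m) := fun i m =>
    MDef.not ⟨Term.equal (Term.var (Sum.inl i)) (Term.var (Sum.inr m)), fun x => by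
      simp [Formula.realize_equal]⟩
  have hd : MDef M (fun x : Fin ny → N => ∃ i, ∀ m : M, ¬ x i = m) :=
    MDef.existsFin fun i => MDef.forallFin fun m => hne i m
  obtain ⟨x, ⟨i, hi⟩, hx⟩ := hd.exists_mpt (by
    push Not at hbM
    obtain ⟨i, hi⟩ := hbM
    exact ⟨b, i, fun m hm => hi (hm ▸ m.2)⟩)
  exact hi ⟨x i, hx i⟩ rfl

theorem main_sem [Nonempty N] (hd : IsDistal L N) (H : SatP M) {nx ny : ℕ}
    {φ : (Fin nx ⊕ Fin ny → N) → Prop} (hφ : MDef M φ) (b : Fin ny → N)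
    (hcons : ∀ c : ℕ → Fin ny → N, IsIndiscernibleOver L (M : Set N) c → TEq M (c 0) b →
      ∀ s : Finset ℕ, ∃ a, ∀ i ∈ s, φ (Sum.elim a (c i))) :
    ∃ (k : ℕ) (θ : (Fin nx ⊕ (Fin k × Fin ny) → N) → Prop) (c0 : Fin k × Fin ny → N)
      (p : Ultrafilter (Fin nx → N)), MDef M θ ∧ FInv M (p : Filter (Fin nx → N)) ∧
      (∀ᶠ a in (p : Filter (Fin nx → N)), θ (Sum.elim a c0)) ∧
      ∀ (ι : Type) [Finite ι] (B : ι → Fin ny → N), (∀ i, TEq M (B i) b) →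
        ∃ c, TEq M c c0 ∧ ∀ i a, θ (Sum.elim a c) → φ (Sum.elim a (B i)) := by
  have hN : NIPsem M := nipsem_of hd.1
  obtain ⟨U, hU, hUb, hst⟩ := exists_strict H hN b
  obtain ⟨b', hb'⟩ := H.exists_morley U (Empty.elim : Empty → N)
  have hb0 : ∀ i, TEq M (b' i) b := by
    intro i
    have h1 : Rlz M U (Empty.elim : Empty → N) (b' i) :=
      (hb' (i + 1) i (by omega)).restrict Sum.inr (fun _ => rfl)
    exact (h1.tEq hU hUb (TEq.refl _)).pre Sum.inl (fun _ => rfl) (fun _ => rfl)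
  have hind : IsIndiscernibleOver L (M : Set N) b' := by
    have main : ∀ (m : ℕ) (i : Fin m → ℕ), StrictMono i →
        ∃ e : ℕ → Fin ny → N, Morley M U (Empty.elim : Empty → N) m e ∧
          ∀ q : Fin m, e q = b' (i q) := by
      intro m i hi
      classical
      let σ : ℕ → ℕ := fun n => if h : n < m then i ⟨n, h⟩ else 0
      have hσ : ∀ (n : ℕ) (h : n < m), σ n = i ⟨n, h⟩ := fun n h => dif_pos h
      refine ⟨fun n => b' (σ n), ?_, fun q => congrArg b' (hσ q q.2)⟩
      refine (hb' ((Finset.univ.sup i) + 1)).sub σ (fun i => i.elim) 0 ?_ ?_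
        (fun _ _ => Nat.zero_le _) (fun i => i.elim) (fun i => i.elim) (fun _ _ => rfl)
      · intro x y hxy hy
        rw [hσ x (hxy.trans hy), hσ y hy]
        exact hi hxy
      · intro x hx
        rw [hσ x hx]
        exact Nat.lt_succ_of_le (Finset.le_sup (f := i) (Finset.mem_univ _))
    intro m i j hi hj
    obtain ⟨e, he, he'⟩ := main m i hi
    obtain ⟨f, hf, hf'⟩ := main m j hj
    exact ((he.tEq hU hf (TEq.refl _)).pre Sum.inl
      (fun q => by simp [pfx, he']) (fun q => by simp [pfx, hf'])).same
  have hfip := hcons b' hind (hb0 0)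
  choose a ha using fun n => hfip (Finset.range n)
  let Θ : Ultrafilter (Fin nx → N) := (Filter.hyperfilter ℕ).map a
  have hΘ : ∀ i, ∀ᶠ x in (Θ : Filter (Fin nx → N)), φ (Sum.elim x (b' i)) := by
    intro i
    have h1 : ∀ᶠ n in ((Filter.hyperfilter ℕ : Ultrafilter ℕ) : Filter ℕ),
        φ (Sum.elim (a n) (b' i)) := by
      refine Nat.hyperfilter_le_atTop ?_
      filter_upwards [Filter.eventually_gt_atTop i] with n hn
      exact ha n i (Finset.mem_range.2 hn)
    exact h1
  have hNe : (genF M φ b).NeBot := by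
    obtain ⟨k, θ, c0, hθ, hev, hB⟩ := dist_partB hd H hφ hU hst b' hb' Θ hΘ
    refine Filter.neBot_iff.2 fun hbot => ?_
    have h1 : (∅ : Set (Fin nx → N)) ∈ genF M φ b := by rw [hbot]; exact Filter.mem_bot
    obtain ⟨ι, hι, B, h2, h3⟩ := mem_genF.1 h1
    obtain ⟨c, hc, h4⟩ := hB ι B h2
    obtain ⟨x, hx⟩ := hev.exists
    obtain ⟨y, hy⟩ := hc.symm _ hθ.exl ⟨x, hx⟩
    exact h3 y fun i => h4 i y hy
  obtain ⟨p, hp, hpi⟩ := broom H hN (genF M φ b) (genF_inv H hφ b)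
  obtain ⟨k, θ, c0, hθ, hev, hB⟩ := dist_partB hd H hφ hU hst b' hb' p
    (fun i => hp (genF_self (hb0 i)))
  exact ⟨k, θ, c0, p, hθ, hpi, hev, hB⟩

end Helpers7

/-- Proposition 4.1 of the paper. Let `M ⪯ N` be models of a complete
distal theory with `N` sufficiently saturated (`|M|⁺`-saturated). Let `φ(x, y)` be an
`L`-formula with parameters `mp` from `M`, let `b` be a tuple from `N` not contained in `M`
with `q(y) = tp(b/M)`, and assume `φ(x, b)` does not divide over `M`. Then there are an
`L`-formula `θ(x, z)` with parameters `mθ` from `M`, a natural number `k` with `|z| = k·|y|`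
(the `z`-variables are indexed by `Fin k × Fin ny`), and a complete type `r(z)` over `M`
(encoded by a realization `c₀` in `N`; all such types are realized in `N` by saturation),
such that for every finite set `B` of tuples from `N` realizing `q(y)` there is a tuple `c`
from `N` with: (1) `c` realizes `r`; (2) `θ(x, c)` does not divide over `M`; and
(3) for all `d ∈ B`, `N ⊨ ∀x (θ(x, c) → φ(x, d))`. -/
theorem statement7 {L : FirstOrder.Language.{u, v}} {N : Type w} [L.Structure N]
    (M : L.ElementarySubstructure N) (hdistal : IsDistal L N)
    (hsat : IsSaturated L (Order.succ (Cardinal.mk M)) N)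
    (nx ny np : ℕ) (φ : L.Formula (Fin nx ⊕ (Fin ny ⊕ Fin np))) (mp : Fin np → M)
    (b : Fin ny → N) (hbM : ¬ ∀ i, b i ∈ M)
    (hndiv : ¬ Divides L (M : Set N) φ (Sum.elim b fun i => ((mp i : N)))) :
    ∃ (k np' : ℕ) (θ : L.Formula (Fin nx ⊕ ((Fin k × Fin ny) ⊕ Fin np')))
      (mθ : Fin np' → M) (c₀ : Fin k × Fin ny → N),
      ∀ (j : ℕ) (B : Fin j → Fin ny → N),
        (∀ i, SameTypeOver L (M : Set N) (B i) b) →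
        ∃ c : Fin k × Fin ny → N,
          SameTypeOver L (M : Set N) c c₀ ∧
          ¬ Divides L (M : Set N) θ (Sum.elim c fun l => ((mθ l : N))) ∧
          ∀ (i : Fin j) (a : Fin nx → N),
            θ.Realize (Sum.elim a (Sum.elim c fun l => ((mθ l : N)))) →
            φ.Realize (Sum.elim a (Sum.elim (B i) fun l => ((mp l : N)))) := by
  have hinf : Infinite M := infinite_of_not_mem b hbM
  have hne : Nonempty N := ⟨((Classical.arbitrary M : M) : N)⟩
  have H : SatP M := satP_of hsat hinf
  have hf0 : MDef M (fun x : Fin nx ⊕ (Fin ny ⊕ Fin np) → N => φ.Realize x) :=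
    ⟨φ.relabel Sum.inl, fun x => by rw [Formula.realize_relabel]; rfl⟩
  have hφ : MDef M (fun x : Fin nx ⊕ Fin ny → N =>
      φ.Realize (Sum.elim (fun i => x (Sum.inl i))
        (Sum.elim (fun i => x (Sum.inr i)) (fun l => ((mp l : N)))))) :=
    hf0.subst _ (Sum.elim (fun i => Sum.inl (Sum.inl i))
      (Sum.elim (fun i => Sum.inl (Sum.inr i)) (fun l => Sum.inr (mp l))))
      (fun x i => by rcases i with i | i | i <;> rfl)
  have ext : ∀ {γ : Type} {x y : γ → N} {n : ℕ} (m : Fin n → M), TEq M x y →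
      TEq M (Sum.elim x fun l => ((m l : N))) (Sum.elim y fun l => ((m l : N))) :=
    fun m h P hP hp => h _ (hP.fixr (fun l => (m l).2)) hp
  obtain ⟨k, θP, c0, p, ⟨ψ, hψ⟩, hpi, hev, hB⟩ := main_sem hdistal H hφ b (by
    intro c hc hc0 s
    refine consistent_of_not_divides hndiv (fun n => Sum.elim (c n) fun i => ((mp i : N))) ?_
      (ext mp hc0).same s
    intro m i j hi hj
    have h1 := ext mp (tEq_of_same (hc m i j hi hj))
    exact (h1.pre (fun q => Sum.elim (fun t => Sum.inl (q.1, t)) (fun l => Sum.inr l) q.2)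
      (by rintro ⟨q, t | t⟩ <;> rfl) (by rintro ⟨q, t | t⟩ <;> rfl)).same)
  obtain ⟨np', ψ', mθ, hm⟩ := formula_support.{u, v, w} ψ
  let θ : L.Formula (Fin nx ⊕ ((Fin k × Fin ny) ⊕ Fin np')) :=
    ψ'.relabel (Equiv.sumAssoc _ _ _)
  have hθ : ∀ a c, θ.Realize (Sum.elim a (Sum.elim c fun l => ((mθ l : N)))) ↔
      θP (Sum.elim a c) := by
    intro a c
    rw [← hψ, ← hm, Formula.realize_relabel]
    apply iff_of_eq; congr 1
    funext i; rcases i with (i | i) | i <;> rfl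
  have hθd : MDef M (fun x : Fin nx ⊕ ((Fin k × Fin ny) ⊕ Fin np') → N => θ.Realize x) :=
    ⟨θ.relabel Sum.inl, fun x => by rw [Formula.realize_relabel]; rfl⟩
  refine ⟨k, np', θ, mθ, c0, fun j B hBs => ?_⟩
  obtain ⟨c, hc, himp⟩ := hB (Fin j) B (fun i => tEq_of_same (hBs i))
  refine ⟨c, hc.same, ?_, fun i a ha => himp i a ((hθ a c).1 ha)⟩
  refine not_divides_of_ultra H θ _ p fun c' hc' => ?_
  refine hpi _ _ hθd (Sum.elim c0 fun l => ((mθ l : N))) c' ((ext mθ hc.symm).trans hc') ?_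
  filter_upwards [hev] with a ha
  exact (hθ a c0).2 ha

end DistalPaper
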